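/- Let 1 ≤ p < 2 and let V : ℝ → ℝ be measurable with ∫_ℝ |V(x)|^p dx < ∞ (and V locally integrable). Then for Lebesgue-almost every k > 0 there exist solutions u₊ and u₋ of the eigenfunction equation −u'' + V u = k²u on ℝ (in the sense that u_± : ℝ → ℂ is differentiable and its derivative satisfies u_±'(x) = u_±'(0) + ∫₀ˣ (V(y) − k²)·u_±(y) dy for all x) such that u₊(x)·exp(−i(kx − (1/(2k))·∫₀ˣ V(y) dy)) → 1 as x → +∞ and u₋(x)·exp(−i(kx − (1/(2k))·∫₀ˣ V(y) dy)) → 1 as x → −∞. -/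

import Mathlib

open Real Set MeasureTheory Filter

/-- `u : ℝ → ℂ` solves `-u'' + V u = E u` in the integral sense:
`u` is differentiable and `u'(x) = u'(0) + ∫₀ˣ (V(y) - E) u(y) dy`. -/
def SchrodingerSolution (V : ℝ → ℝ) (E : ℝ) (u : ℝ → ℂ) : Prop :=
  Differentiable ℝ u ∧
    ∀ x : ℝ, deriv u x = deriv u 0 + ∫ y in (0:ℝ)..x, ((V y : ℂ) - (E : ℂ)) * u y

/-- `u` has WKB asymptotics at the filter `l` (`atTop` or `atBot`) for momentum `k`:
`u(x) exp(-i(kx - (1/(2k)) ∫₀ˣ V)) → 1`. -/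
def HasWKBAsymptotics (V : ℝ → ℝ) (k : ℝ) (u : ℝ → ℂ) (l : Filter ℝ) : Prop :=
  Tendsto (fun x : ℝ =>
      u x * Complex.exp (-(Complex.I *
        ((k * x - (1 / (2 * k)) * ∫ y in (0:ℝ)..x, V y : ℝ) : ℂ)))) l (nhds 1)

def Prim (F f : ℝ → ℂ) : Prop :=
  LocallyIntegrable f ∧ ∀ x, F x = F 0 + ∫ t in (0:ℝ)..x, f t

theorem locInt_ii {E : Type*} [NormedAddCommGroup E] {f : ℝ → E} (h : LocallyIntegrable f) (a b : ℝ) :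
    IntervalIntegrable f volume a b := by
  exact (MeasureTheory.LocallyIntegrable.integrableOn_isCompact h isCompact_uIcc).intervalIntegrable

theorem locInt_norm {E : Type*} [NormedAddCommGroup E] {f : ℝ → E} (h : LocallyIntegrable f) :
    LocallyIntegrable (fun x => ‖f x‖) := by
  intro x
  obtain ⟨s, hs, hi⟩ := h x
  exact ⟨s, hs, hi.norm⟩

theorem Prim.sub_eq {F f : ℝ → ℂ} (h : Prim F f) (x y : ℝ) : F y - F x = ∫ t in x..y, f t := by
  rw [h.2 y, h.2 x, add_sub_add_left_eq_sub]
  exact intervalIntegral.integral_interval_sub_left (locInt_ii h.1 _ _) (locInt_ii h.1 _ _)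

theorem Prim.continuous {F f : ℝ → ℂ} (h : Prim F f) : Continuous F := by
  have : F = fun x => F 0 + ∫ t in (0:ℝ)..x, f t := funext h.2
  rw [this]
  exact continuous_const.add (intervalIntegral.continuous_primitive (locInt_ii h.1) 0)

theorem ac_of_dist {X Y : Type*} [PseudoMetricSpace X] [PseudoMetricSpace Y] {F : ℝ → X} {g : ℝ → Y} {a b : ℝ} (hg : AbsolutelyContinuousOnInterval g a b)
    (h : ∀ x y, dist (F x) (F y) ≤ dist (g x) (g y)) : AbsolutelyContinuousOnInterval F a b := by
  unfold AbsolutelyContinuousOnInterval at *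
  refine squeeze_zero (fun _ => Finset.sum_nonneg fun _ _ => dist_nonneg) (fun E => ?_) hg
  exact Finset.sum_le_sum fun i _ => h _ _

theorem ac_prim {w : ℝ → ℝ} (hw : LocallyIntegrable w) (a b : ℝ) :
    AbsolutelyContinuousOnInterval (fun x => ∫ t in (0:ℝ)..x, w t) a b := by
  have h1 : AbsolutelyContinuousOnInterval (fun x => ∫ t in a..x, w t) a b :=
    (locInt_ii hw a b).absolutelyContinuousOnInterval_intervalIntegral (by simp)
  refine ac_of_dist h1 fun x y => le_of_eq ?_
  simp only [Real.dist_eq]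
  rw [intervalIntegral.integral_interval_sub_left (locInt_ii hw _ _) (locInt_ii hw _ _),
    intervalIntegral.integral_interval_sub_left (locInt_ii hw _ _) (locInt_ii hw _ _)]

theorem Prim.ac {F f : ℝ → ℂ} (h : Prim F f) (a b : ℝ) : AbsolutelyContinuousOnInterval F a b := by
  refine ac_of_dist (ac_prim (locInt_norm h.1) a b) fun x y => ?_
  rw [dist_comm, Complex.dist_eq, h.sub_eq, dist_comm, Real.dist_eq,
    intervalIntegral.integral_interval_sub_left (locInt_ii (locInt_norm h.1) _ _) (locInt_ii (locInt_norm h.1) _ _)]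
  exact intervalIntegral.norm_integral_le_abs_integral_norm

theorem Prim.ae_deriv {F f : ℝ → ℂ} (h : Prim F f) : ∀ᵐ x, HasDerivAt F (f x) x := by
  have := LocallyIntegrable.ae_hasDerivAt_integral h.1
  filter_upwards [this] with x hx
  have h2 := (hx 0).const_add (F 0)
  have e : F = fun x => F 0 + ∫ t in (0:ℝ)..x, f t := funext h.2
  rw [e]; simpa using h2

theorem prim_of_ac {F f : ℝ → ℂ} (hac : ∀ a b, AbsolutelyContinuousOnInterval F a b)
    (hf : LocallyIntegrable f) (hd : ∀ᵐ x, HasDerivAt F (f x) x) : Prim F f := by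
  refine ⟨hf, fun x => ?_⟩
  have hG : Prim (fun x => ∫ t in (0:ℝ)..x, f t) f := ⟨hf, by simp⟩
  have h1 := (hac 0 x).sub (hG.ac 0 x)
  have h2 : ∀ᵐ t, HasDerivAt (F - fun x => ∫ t in (0:ℝ)..x, f t) 0 t := by
    filter_upwards [hd, hG.ae_deriv] with t h h'
    simpa using h.sub h'
  have := AbsolutelyContinuousOnInterval.const_of_ae_hasDerivAt_zero h1
    (by filter_upwards [h2] with t ht _ using ht)
  obtain ⟨c, hc⟩ := this
  have h0 := hc 0 (by simp)
  have hx := hc x (by simp)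
  simp at h0 hx
  rw [h0, ← hx]; ring

theorem locInt_mul {f g : ℝ → ℂ} (hf : LocallyIntegrable f) (hg : Continuous g) :
    LocallyIntegrable (fun x => f x * g x) := by
  have := hf.smul_continuous  hg
  exact this

theorem Prim.mul {F f G g : ℝ → ℂ} (hF : Prim F f) (hG : Prim G g) :
    Prim (fun x => F x * G x) (fun x => f x * G x + g x * F x) := by
  refine prim_of_ac (fun a b => (hF.ac a b).smul (hG.ac a b)) ?_ ?_
  · exact (locInt_mul hF.1 hG.continuous).add (locInt_mul hG.1 hF.continuous)
  · filter_upwards [hF.ae_deriv, hG.ae_deriv] with x h1 h2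
    exact (h1.mul h2).congr_deriv (by ring)

theorem Prim.add {F f G g : ℝ → ℂ} (hF : Prim F f) (hG : Prim G g) :
    Prim (fun x => F x + G x) (fun x => f x + g x) := by
  refine ⟨hF.1.add hG.1, fun x => ?_⟩
  show F x + G x = F 0 + G 0 + _
  rw [intervalIntegral.integral_add (locInt_ii hF.1 _ _) (locInt_ii hG.1 _ _), hF.2 x, hG.2 x]; ring

theorem Prim.const_mul {F f : ℝ → ℂ} (c : ℂ) (hF : Prim F f) :
    Prim (fun x => c * F x) (fun x => c * f x) := by
  refine ⟨?_, fun x => ?_⟩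
  · have := hF.1.smul c
    exact this
  · show c * F x = c * F 0 + _
    rw [intervalIntegral.integral_const_mul, hF.2 x]; ring

theorem Prim.conj {F f : ℝ → ℂ} (hF : Prim F f) :
    Prim (fun x => star (F x)) (fun x => star (f x)) := by
  refine prim_of_ac (fun a b => ?_) ?_ ?_
  · exact ac_of_dist (hF.ac a b) fun x y => (dist_star_star _ _).le
  · intro x
    obtain ⟨s, hs, hi⟩ := hF.1 x
    refine ⟨s, hs, ?_⟩
    exact (Complex.conjCLE.toContinuousLinearMap.integrable_comp hi)
  · filter_upwards [hF.ae_deriv] with x h1 using h1.star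

theorem prim_expI {w : ℝ → ℝ} (hw : LocallyIntegrable w) :
    Prim (fun x => Complex.exp (Complex.I * ((∫ t in (0:ℝ)..x, w t : ℝ) : ℂ)))
     (fun x => (Complex.I * (w x : ℂ)) * Complex.exp (Complex.I * ((∫ t in (0:ℝ)..x, w t : ℝ) : ℂ))) := by
  have hwC : LocallyIntegrable (fun x => (w x : ℂ)) := by
    intro x
    obtain ⟨s, hs, hi⟩ := hw x
    exact ⟨s, hs, hi.ofReal⟩
  have hcont : Continuous (fun x => ∫ t in (0:ℝ)..x, w t) :=
    intervalIntegral.continuous_primitive (locInt_ii hw) 0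
  refine prim_of_ac (fun a b => ?_) ?_ ?_
  · refine ac_of_dist (ac_prim hw a b) fun x y => ?_
    have key : ∀ r s : ℝ, dist (Complex.exp (Complex.I * r)) (Complex.exp (Complex.I * s)) ≤ dist r s := by
      intro r s
      have : Complex.exp (Complex.I * r) - Complex.exp (Complex.I * s) =
          Complex.exp (Complex.I * s) * (Complex.exp (Complex.I * ((r - s : ℝ):ℂ)) - 1) := by
        rw [mul_sub, ← Complex.exp_add]; push_cast; ring_nf
      rw [Complex.dist_eq, this, norm_mul, mul_comm Complex.I (s:ℂ), Complex.norm_exp_ofReal_mul_I, one_mul, Real.dist_eq]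
      exact Real.norm_exp_I_mul_ofReal_sub_one_le
    exact key _ _
  · refine locInt_mul (f := fun x => Complex.I * (w x : ℂ)) ?_ (by fun_prop)
    exact hwC.smul Complex.I
  · filter_upwards [LocallyIntegrable.ae_hasDerivAt_integral hw] with x hx
    have := ((hx 0).ofReal_comp.const_mul Complex.I).cexp
    exact this.congr_deriv (by ring)

noncomputable def Pic (ζ : ℝ → ℂ) (y0 : ℂ) : ℕ → ℝ → ℂ
  | 0 => fun _ => y0
  | n + 1 => fun x => ∫ t in (0:ℝ)..x, ζ t * star (Pic ζ y0 n t)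

theorem Pic_cont {ζ : ℝ → ℂ} (hζ : LocallyIntegrable ζ) (y0 : ℂ) (n : ℕ) : Continuous (Pic ζ y0 n) := by
  induction n with
  | zero => exact continuous_const
  | succ n ih =>
    exact intervalIntegral.continuous_primitive (locInt_ii (locInt_mul hζ (continuous_star.comp ih))) 0

theorem phi_pow {w : ℝ → ℝ} (hw : LocallyIntegrable w) (n : ℕ) (x : ℝ) :
    ∫ t in (0:ℝ)..x, w t * (∫ s in (0:ℝ)..t, w s) ^ n = (∫ s in (0:ℝ)..x, w s) ^ (n+1) / (n+1) := by
  have hwC : LocallyIntegrable (fun x => (w x : ℂ)) := by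
    intro x
    obtain ⟨s, hs, hi⟩ := hw x
    exact ⟨s, hs, hi.ofReal⟩
  have h1 : Prim (fun x => ((∫ s in (0:ℝ)..x, w s : ℝ) : ℂ)) (fun x => (w x : ℂ)) := by
    refine ⟨hwC, fun x => ?_⟩
    simp [intervalIntegral.integral_ofReal]
  have h2 : ∀ n : ℕ, Prim (fun x => ((∫ s in (0:ℝ)..x, w s : ℝ) : ℂ) ^ (n+1))
      (fun x => (n+1) * (w x * ((∫ s in (0:ℝ)..x, w s : ℝ) : ℂ) ^ n)) := by
    intro n
    induction n with
    | zero => simpa using h1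
    | succ n ih =>
      have := ih.mul h1
      convert this using 2 <;> (push_cast; ring)
  have h3 := (h2 n).2 x
  simp only [intervalIntegral.integral_same, intervalIntegral.integral_const_mul] at h3
  have h4 : ((∫ t in (0:ℝ)..x, w t * (∫ s in (0:ℝ)..t, w s) ^ n : ℝ) : ℂ)
     = ∫ t in (0:ℝ)..x, (w t * ((∫ s in (0:ℝ)..t, w s : ℝ) : ℂ) ^ n) := by
    rw [← intervalIntegral.integral_ofReal]; simp
  rw [← h4] at h3
  have h5 : (∫ s in (0:ℝ)..x, w s) ^ (n+1) = (n+1) * ∫ t in (0:ℝ)..x, w t * (∫ s in (0:ℝ)..t, w s) ^ n := by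
    have h6 : (((∫ s in (0:ℝ)..x, w s) ^ (n+1) : ℝ) : ℂ) = (((n+1) * ∫ t in (0:ℝ)..x, w t * (∫ s in (0:ℝ)..t, w s) ^ n : ℝ) : ℂ) := by
      push_cast [h3]; simp
    exact_mod_cast h6
  rw [h5]; field_simp

theorem Pic_bound {ζ : ℝ → ℂ} (hζ : LocallyIntegrable ζ) (y0 : ℂ) (n : ℕ) (x : ℝ) :
    ‖Pic ζ y0 n x‖ ≤ ‖y0‖ * (|∫ t in (0:ℝ)..x, ‖ζ t‖| ^ n / n.factorial) := by
  have hz := locInt_norm hζ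
  induction n generalizing x with
  | zero => simp [Pic]
  | succ n ih =>
    obtain ⟨σ, hσ1, hσ⟩ : ∃ σ : ℝ, |σ| = 1 ∧ ∀ t ∈ uIoc 0 x, |∫ s in (0:ℝ)..t, ‖ζ s‖| = σ * ∫ s in (0:ℝ)..t, ‖ζ s‖ := by
      rcases le_total 0 x with h | h
      · refine ⟨1, by simp, fun t ht => ?_⟩
        rw [uIoc_of_le h] at ht
        rw [one_mul, abs_of_nonneg]
        exact intervalIntegral.integral_nonneg ht.1.le fun _ _ => norm_nonneg _
      · refine ⟨-1, by simp, fun t ht => ?_⟩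
        rw [uIoc_of_ge h] at ht
        rw [abs_of_nonpos]; · ring
        rw [intervalIntegral.integral_symm]
        simp only [Left.neg_nonpos_iff]
        exact intervalIntegral.integral_nonneg ht.2 fun _ _ => norm_nonneg _
    have hc : Continuous (fun x => ∫ s in (0:ℝ)..x, ‖ζ s‖) :=
      intervalIntegral.continuous_primitive (locInt_ii hz) 0
    have hI : LocallyIntegrable (fun t => ‖ζ t‖ * (∫ s in (0:ℝ)..t, ‖ζ s‖) ^ n) :=
      hz.smul_continuous (hc.pow n)
    have := intervalIntegral.norm_integral_le_abs_of_norm_le (f := fun t => ζ t * star (Pic ζ y0 n t))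
      (a := 0) (b := x) (μ := volume)
      (g := fun t => (‖y0‖ / n.factorial * σ ^ n) * (‖ζ t‖ * (∫ s in (0:ℝ)..t, ‖ζ s‖) ^ n))
      (by
        rw [ae_restrict_iff' measurableSet_uIoc]
        refine Eventually.of_forall fun t ht => ?_
        rw [norm_mul, norm_star]
        calc _ ≤ ‖ζ t‖ * (‖y0‖ * (|∫ t in (0:ℝ)..t, ‖ζ t‖| ^ n / n.factorial)) := by gcongr; exact ih t
          _ = _ := by rw [hσ t ht, mul_pow]; ring)
      ((locInt_ii hI _ _).const_mul _)
    refine this.trans (le_of_eq ?_)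
    rw [intervalIntegral.integral_const_mul, phi_pow hz, abs_mul, abs_mul, abs_div, abs_div, abs_pow, abs_pow, hσ1,
      abs_of_nonneg (norm_nonneg _), Nat.factorial_succ, abs_of_nonneg (by positivity : (0:ℝ) ≤ n + 1)]
    simp only [Nat.abs_cast]
    push_cast
    rw [one_pow]
    field_simp

theorem volterra {ζ : ℝ → ℂ} (hζ : LocallyIntegrable ζ) (y0 : ℂ) :
    ∃ y : ℝ → ℂ, y 0 = y0 ∧ Prim y (fun x => ζ x * star (y x)) := by
  have hz := locInt_norm hζ
  have hc : Continuous (fun x => ∫ s in (0:ℝ)..x, ‖ζ s‖) :=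
      intervalIntegral.continuous_primitive (locInt_ii hz) 0
  have hB : ∀ a b : ℝ, ∃ C : ℝ, 0 ≤ C ∧ ∀ n, ∀ x ∈ uIcc a b, ‖Pic ζ y0 n x‖ ≤ ‖y0‖ * (C ^ n / n.factorial) := by
    intro a b
    obtain ⟨C, hC⟩ := (isCompact_uIcc (a := a) (b := b)).exists_bound_of_continuousOn hc.continuousOn
    refine ⟨C, (norm_nonneg _).trans (hC a (by simp)), fun n x hx => (Pic_bound hζ y0 n x).trans ?_⟩
    gcongr
    exact hC x hx
  have hS : ∀ C : ℝ, Summable fun n : ℕ => ‖y0‖ * (C ^ n / n.factorial) := fun C =>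
    (Real.summable_pow_div_factorial C).mul_left _
  have hsum : ∀ x, Summable (fun n => Pic ζ y0 n x) := fun x => by
    obtain ⟨C, _, hC⟩ := hB x x
    exact Summable.of_norm_bounded (hS C) fun n => hC n x (by simp)
  set y : ℝ → ℂ := fun x => ∑' n, Pic ζ y0 n x with hy
  have hycont : Continuous y := by
    rw [continuous_iff_continuousAt]
    intro x
    obtain ⟨C, _, hC⟩ := hB (x-1) (x+1)
    have : ContinuousOn y (uIcc (x-1) (x+1)) :=
      continuousOn_tsum (fun n => (Pic_cont hζ y0 n).continuousOn) (hS C) hC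
    refine this.continuousAt ?_
    rw [uIcc_of_le (by linarith)]
    exact Icc_mem_nhds (by linarith) (by linarith)
  have hy0 : y 0 = y0 := by
    rw [hy]
    show ∑' n, Pic ζ y0 n 0 = y0
    rw [tsum_eq_single 0]
    · rfl
    · intro n hn
      obtain ⟨m, rfl⟩ := Nat.exists_eq_succ_of_ne_zero hn
      simp [Pic]
  refine ⟨y, hy0, locInt_mul hζ (continuous_star.comp hycont), fun x => ?_⟩
  obtain ⟨C, hC0, hC⟩ := hB 0 x
  have h1 := intervalIntegral.hasSum_integral_of_dominated_convergence (a := 0) (b := x) (μ := volume)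
    (F := fun n t => ζ t * star (Pic ζ y0 n t)) (f := fun t => ζ t * star (y t))
    (fun n t => ‖ζ t‖ * (‖y0‖ * (C ^ n / n.factorial)))
    (fun n => (locInt_mul hζ (continuous_star.comp (Pic_cont hζ y0 n))).aestronglyMeasurable.restrict)
    (fun n => Eventually.of_forall fun t ht => by
      rw [norm_mul, norm_star]
      gcongr
      exact hC n t (uIoc_subset_uIcc ht))
    (Eventually.of_forall fun t _ => (hS C).mul_left _)
    (by
      simp_rw [tsum_mul_left]
      exact (locInt_ii hz _ _).mul_const _)
    (Eventually.of_forall fun t _ => ((hsum t).hasSum.star).mul_left _)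
  have h2 : HasSum (fun n => Pic ζ y0 (n+1) x) (∫ t in (0:ℝ)..x, ζ t * star (y t)) := h1
  have h3 := (hsum x).hasSum
  rw [← hasSum_nat_add_iff' 1] at h3
  have h4 := h2.unique h3
  rw [h4, hy0]
  simp [Pic, hy]

noncomputable def dy (m n : ℕ) : ℝ := (n : ℝ) / 2 ^ m

theorem dy_double (m n : ℕ) : dy (m+1) (2*n) = dy m n := by
  unfold dy; push_cast; rw [pow_succ]; field_simp

theorem dy_mono (m : ℕ) {n n' : ℕ} (h : n ≤ n') : dy m n ≤ dy m n' := by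
  unfold dy; gcongr

theorem dy_nonneg (m n : ℕ) : 0 ≤ dy m n := by unfold dy; positivity

theorem dy_lt_one {m n : ℕ} (h : n < 2 ^ m) : dy m n < 1 := by
  unfold dy; rw [div_lt_one (by positivity)]; exact_mod_cast h

theorem dy_succ_sub (m n : ℕ) : dy m (n+1) - dy m n = 1 / 2 ^ m := by
  unfold dy; push_cast; ring

theorem seq_young {S g h : ℕ → ℝ} (hS : ∀ l, 0 ≤ S l) (hg : ∀ l, 0 ≤ g l) (hh : ∀ l, 0 ≤ h l)
    {G H : ℝ} (hrec : ∀ l, S l ≤ (1 + g l) * S (l+1) + h l)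
    (hlim : Tendsto S atTop (nhds 0))
    (hG : ∀ L, ∑ l ∈ Finset.range L, g l ≤ G) (hH : ∀ L, ∑ l ∈ Finset.range L, h l ≤ H) :
    S 0 ≤ exp G * H := by
  have hP : ∀ L, ∏ l ∈ Finset.range L, (1 + g l) ≤ exp G := fun L => by
    calc _ ≤ ∏ l ∈ Finset.range L, exp (g l) :=
          Finset.prod_le_prod (fun l _ => by linarith [hg l]) fun l _ => by linarith [add_one_le_exp (g l)]
      _ = exp (∑ l ∈ Finset.range L, g l) := (exp_sum _ _).symm
      _ ≤ _ := exp_le_exp.2 (hG L)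
  have hP0 : ∀ L, 0 ≤ ∏ l ∈ Finset.range L, (1 + g l) := fun L =>
    Finset.prod_nonneg fun l _ => by linarith [hg l]
  have key : ∀ L, S 0 ≤ (∏ l ∈ Finset.range L, (1 + g l)) * S L + exp G * ∑ l ∈ Finset.range L, h l := by
    intro L
    induction L with
    | zero => simp
    | succ L ih =>
      rw [Finset.prod_range_succ, Finset.sum_range_succ]
      have h1 := mul_le_mul_of_nonneg_left (hrec L) (hP0 L)
      have h2 := mul_le_mul_of_nonneg_right (hP L) (hh L)
      nlinarith
  have h2 : ∀ L, S 0 ≤ exp G * S L + exp G * H := fun L => by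
    refine (key L).trans ?_
    gcongr
    · exact hS L
    · exact hP L
    · exact hH L
  have := ge_of_tendsto ((hlim.const_mul (exp G)).add_const (exp G * H)) (Eventually.of_forall h2)
  simpa using this

theorem sum_double (F : ℕ → ℝ) {a b : ℕ} (h : a ≤ b) :
    ∑ i ∈ Finset.Ico a b, (F (2*i) + F (2*i+1)) = ∑ i ∈ Finset.Ico (2*a) (2*b), F i := by
  induction b, h using Nat.le_induction with
  | base => simp
  | succ b hb ih =>
    rw [Finset.sum_Ico_succ_top hb, ih, show 2*(b+1) = 2*b+1+1 by ring,
      Finset.sum_Ico_succ_top (by omega), Finset.sum_Ico_succ_top (by omega)]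
    ring

noncomputable def dz (Z : ℝ → ℂ) (m n : ℕ) : ℝ := ‖Z (dy m (n+1)) - Z (dy m n)‖

noncomputable def rr (f Z : ℝ → ℂ) (m n : ℕ) : ℝ :=
  ‖f (dy m (n+1)) - f (dy m n) - (Z (dy m (n+1)) - Z (dy m n)) * star (f (dy m n))‖

theorem rr_rec (f Z : ℝ → ℂ) (m n : ℕ) {Y g : ℝ} (hY : ‖f (dy m n)‖ ≤ Y)
    (hg : dz Z (m+1) (2*n+1) ≤ g) :
    rr f Z m n ≤ (1 + g) * (rr f Z (m+1) (2*n) + rr f Z (m+1) (2*n+1)) +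
      Y * (dz Z (m+1) (2*n) ^ 2 + dz Z (m+1) (2*n+1) ^ 2) := by
  have e1 : dy m n = dy (m+1) (2*n) := (dy_double m n).symm
  have e2 : dy m (n+1) = dy (m+1) (2*n+1+1) := (dy_double m (n+1)).symm
  have hY0 : 0 ≤ Y := (norm_nonneg _).trans hY
  unfold rr dz at *
  rw [e1] at hY
  rw [e1, e2]
  set A := dy (m+1) (2*n)
  set B := dy (m+1) (2*n+1)
  set D := dy (m+1) (2*n+1+1)
  have e : f D - f A - (Z D - Z A) * star (f A) =
      (f B - f A - (Z B - Z A) * star (f A)) + (f D - f B - (Z D - Z B) * star (f B))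
      + (Z D - Z B) * star ((f B - f A - (Z B - Z A) * star (f A)) + (Z B - Z A) * star (f A)) := by
    simp only [star_add, star_sub, star_mul', star_star]; ring
  rw [e]
  set R1 := f B - f A - (Z B - Z A) * star (f A)
  set R2 := f D - f B - (Z D - Z B) * star (f B)
  have n1 : ‖R1 + R2 + (Z D - Z B) * star (R1 + (Z B - Z A) * star (f A))‖ ≤
      ‖R1‖ + ‖R2‖ + ‖Z D - Z B‖ * (‖R1‖ + ‖Z B - Z A‖ * ‖f A‖) := by
    refine (norm_add_le _ _).trans (add_le_add (norm_add_le _ _) ?_)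
    rw [norm_mul, norm_star]
    gcongr
    refine (norm_add_le _ _).trans ?_
    rw [norm_mul, norm_star]
  refine n1.trans ?_
  have i1 : ‖Z D - Z B‖ * ‖R1‖ ≤ g * ‖R1‖ := by gcongr
  have i2 : 0 ≤ g * ‖R2‖ := mul_nonneg ((norm_nonneg _).trans hg) (norm_nonneg _)
  have i3 : ‖Z D - Z B‖ * (‖Z B - Z A‖ * ‖f A‖) ≤ Y * (‖Z B - Z A‖ ^ 2 + ‖Z D - Z B‖ ^ 2) := by
    have : ‖Z D - Z B‖ * ‖Z B - Z A‖ ≤ ‖Z B - Z A‖ ^ 2 + ‖Z D - Z B‖ ^ 2 := by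
      nlinarith [sq_nonneg (‖Z D - Z B‖ - ‖Z B - Z A‖), sq_nonneg (‖Z D - Z B‖), sq_nonneg (‖Z B - Z A‖)]
    calc _ = (‖Z D - Z B‖ * ‖Z B - Z A‖) * ‖f A‖ := by ring
      _ ≤ (‖Z B - Z A‖ ^ 2 + ‖Z D - Z B‖ ^ 2) * Y := by gcongr
      _ = _ := by ring
  nlinarith

theorem geom_bound {q : ℝ} (hq0 : 0 < q) (hq1 : q < 1) (m L : ℕ) :
    ∑ l ∈ Finset.range L, q ^ (m + l + 1) ≤ q ^ m / (1 - q) := by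
  have h1 : ∑ l ∈ Finset.range L, q ^ (m + l + 1) = q ^ (m+1) * ∑ l ∈ Finset.range L, q ^ l := by
    rw [Finset.mul_sum]; refine Finset.sum_congr rfl fun l _ => ?_; ring
  have h2 : ∑ l ∈ Finset.range L, q ^ l ≤ (1-q)⁻¹ := by
    rw [← tsum_geometric_of_lt_one hq0.le hq1]
    exact (summable_geometric_of_lt_one hq0.le hq1).sum_le_tsum _ fun _ _ => by positivity
  have h3 : 0 < 1 - q := by linarith
  rw [h1, div_eq_mul_inv]
  have h4 : q ^ (m+1) ≤ q ^ m := pow_le_pow_of_le_one hq0.le hq1.le (by omega)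
  gcongr

section young
variable {f Z : ℝ → ℂ} {C q : ℝ}

theorem dz_le (hC : 0 ≤ C) (hq0 : 0 < q)
    (hZ : ∀ m, ∑ n ∈ Finset.range (2^m - 1), dz Z m n ^ 2 ≤ (C * q ^ m) ^ 2) {m n : ℕ} (h : n + 1 < 2 ^ m) :
    dz Z m n ≤ C * q ^ m := by
  have h1 : dz Z m n ^ 2 ≤ (C * q ^ m) ^ 2 :=
    (Finset.single_le_sum (f := fun n => dz Z m n ^ 2) (fun _ _ => sq_nonneg _)
      (Finset.mem_range.2 (by omega))).trans (hZ m)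
  exact (pow_le_pow_iff_left₀ (norm_nonneg _) (by positivity) (by norm_num)).1 h1

theorem rr_bound (hC : 0 ≤ C) (hq0 : 0 < q) (hq1 : q < 1)
    (hloc : ∀ b, 0 ≤ b → b < 1 → ∃ K, 0 ≤ K ∧ ∀ a c, 0 ≤ a → a ≤ c → c ≤ b →
      ‖f c - f a‖ ≤ K * (c - a) ∧ ‖f c - f a - (Z c - Z a) * star (f a)‖ ≤ K * (c - a) ^ 2)
    (hZ : ∀ m, ∑ n ∈ Finset.range (2^m - 1), dz Z m n ^ 2 ≤ (C * q ^ m) ^ 2)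
    {m n : ℕ} (hn : n + 1 < 2 ^ m) {Y : ℝ} (hY : ∀ t, dy m n ≤ t → t ≤ dy m (n+1) → ‖f t‖ ≤ Y) :
    rr f Z m n ≤ exp (C / (1 - q)) * (Y * C ^ 2 / (1 - q) * q ^ m) := by
  have hq2 : 0 < 1 - q := by linarith
  have hY0 : 0 ≤ Y := (norm_nonneg _).trans (hY _ le_rfl (dy_mono m (by omega)))
  set S : ℕ → ℝ := fun l => ∑ i ∈ Finset.Ico (2^l * n) (2^l * (n+1)), rr f Z (m+l) i with hS
  have dyl : ∀ l k, dy (m+l) (2^l * k) = dy m k := by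
    intro l k; unfold dy; push_cast; rw [pow_add]; field_simp
  have hlt : ∀ l i, i < 2^l*(n+1) → i + 1 < 2 ^ (m+l) := by
    intro l i hi
    have : 2^l * (n+1) < 2^l * 2^m := Nat.mul_lt_mul_of_pos_left hn (by positivity)
    rw [pow_add, mul_comm (2^m)]; omega
  have hSnn : ∀ l, 0 ≤ S l := fun l => Finset.sum_nonneg fun i _ => by unfold rr; exact norm_nonneg _
  have hS0 : S 0 = rr f Z m n := by simp [hS]
  rw [← hS0]
  refine seq_young (g := fun l => C * q ^ (m+l+1)) (h := fun l => Y * (C * q^(m+l+1))^2)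
    hSnn (fun l => by positivity) (fun l => by positivity) ?_ ?_ ?_ ?_
  · intro l
    calc S l ≤ ∑ i ∈ Finset.Ico (2^l * n) (2^l * (n+1)), ((1 + C * q ^ (m+l+1)) * (rr f Z (m+l+1) (2*i) + rr f Z (m+l+1) (2*i+1)) +
            Y * (dz Z (m+l+1) (2*i) ^ 2 + dz Z (m+l+1) (2*i+1) ^ 2)) := by
          refine Finset.sum_le_sum fun i hi => ?_
          rw [Finset.mem_Ico] at hi
          refine rr_rec f Z (m+l) i (hY _ ?_ ?_) ?_
          · rw [← dyl l n]; exact dy_mono _ hi.1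
          · rw [← dyl l (n+1)]; exact dy_mono _ hi.2.le
          · refine dz_le hC hq0 hZ ?_
            have := hlt l i hi.2
            rw [pow_succ]; omega
      _ = (1 + C * q ^ (m+l+1)) * S (l+1) + Y * ∑ i ∈ Finset.Ico (2^(l+1) * n) (2^(l+1) * (n+1)), dz Z (m+l+1) i ^ 2 := by
          rw [Finset.sum_add_distrib, ← Finset.mul_sum, ← Finset.mul_sum, 
            sum_double (fun i => rr f Z (m+l+1) i) (Nat.mul_le_mul_left _ (by omega)),
            sum_double (fun i => dz Z (m+l+1) i ^ 2) (Nat.mul_le_mul_left _ (by omega))]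
          simp only [hS, pow_succ, mul_comm (2^l) 2, mul_assoc, add_assoc]
      _ ≤ _ := by
          gcongr
          refine (Finset.sum_le_sum_of_subset_of_nonneg ?_ fun _ _ _ => sq_nonneg _).trans (hZ (m+l+1))
          intro i hi
          rw [Finset.mem_Ico] at hi
          have := hlt (l+1) i hi.2
          rw [Finset.mem_range]
          rw [← add_assoc] at this
          omega
  · obtain ⟨K, hK0, hK⟩ := hloc (dy m (n+1)) (dy_nonneg _ _) (dy_lt_one hn)
    have hb : ∀ l, S l ≤ K * (1/2)^l := by
      intro l
      calc S l ≤ ∑ i ∈ Finset.Ico (2^l * n) (2^l * (n+1)), K * (1/2^(m+l))^2 := by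
            refine Finset.sum_le_sum fun i hi => ?_
            rw [Finset.mem_Ico] at hi
            rw [← dy_succ_sub (m+l) i]
            refine (hK _ _ (dy_nonneg _ _) (dy_mono _ (by omega)) ?_).2
            rw [← dyl l (n+1)]; exact dy_mono _ hi.2
        _ = K * (1/2)^l * (1/2^m)^2 := by
            rw [Finset.sum_const, Nat.card_Ico, ← Nat.mul_sub, nsmul_eq_mul]
            simp; field_simp
            rw [pow_add]; ring
        _ ≤ K * (1/2)^l * 1 := by
            gcongr
            refine pow_le_one₀ (by positivity) ?_
            rw [div_le_one (by positivity)]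
            exact one_le_pow₀ (by norm_num)
        _ = _ := by ring
    refine squeeze_zero hSnn hb ?_
    have := (tendsto_pow_atTop_nhds_zero_of_lt_one (r := (1/2:ℝ)) (by norm_num) (by norm_num)).const_mul K
    simpa using this
  · intro L
    rw [← Finset.mul_sum, div_eq_mul_one_div]
    gcongr
    refine (geom_bound hq0 hq1 m L).trans ?_
    gcongr
    exact pow_le_one₀ hq0.le hq1.le
  · intro L
    calc _ ≤ ∑ l ∈ Finset.range L, Y * C^2 * q^(m+l+1) := by
          refine Finset.sum_le_sum fun l _ => ?_
          have : (q^(m+l+1))^2 ≤ q^(m+l+1) := by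
            rw [sq]
            exact mul_le_of_le_one_left (by positivity) (pow_le_one₀ hq0.le hq1.le)
          rw [mul_pow, ← mul_assoc]
          gcongr
      _ ≤ Y * C^2 * (q^m/(1-q)) := by
          rw [← Finset.mul_sum]; gcongr; exact geom_bound hq0 hq1 m L
      _ = _ := by ring

theorem young_chain (hC : 0 ≤ C) (hq0 : 0 < q) (hq1 : q < 1)
    (hloc : ∀ b, 0 ≤ b → b < 1 → ∃ K, 0 ≤ K ∧ ∀ a c, 0 ≤ a → a ≤ c → c ≤ b →
      ‖f c - f a‖ ≤ K * (c - a) ∧ ‖f c - f a - (Z c - Z a) * star (f a)‖ ≤ K * (c - a) ^ 2)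
    (hZ : ∀ m, ∑ n ∈ Finset.range (2^m - 1), dz Z m n ^ 2 ≤ (C * q ^ m) ^ 2) :
    ∃ C3, 0 ≤ C3 ∧ ∀ (m0 : ℕ) (b Y : ℝ), dy m0 (2^m0-1) ≤ b → b < 1 →
      (∀ t, dy m0 (2^m0-1) ≤ t → t ≤ b → ‖f t‖ ≤ Y) →
      ∀ t, dy m0 (2^m0-1) ≤ t → t ≤ b → ‖f t - f (dy m0 (2^m0-1))‖ ≤ Y * C3 * q ^ m0 := by
  have hq2 : 0 < 1 - q := by linarith
  set C2 := exp (C / (1 - q)) * (C ^ 2 / (1 - q)) + C with hC2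
  have hC20 : 0 ≤ C2 := by positivity
  refine ⟨C2 / (1-q), by positivity, fun m0 b Y hb hb1 hY => ?_⟩
  have hY0 : 0 ≤ Y := (norm_nonneg _).trans (hY _ le_rfl hb)
  have dyl : ∀ l k, dy (m0+l) (2^l * k) = dy m0 k := by
    intro l k; unfold dy; push_cast; rw [pow_add]; field_simp
  have hinc : ∀ m n, dy m0 (2^m0-1) ≤ dy m n → dy m (n+1) ≤ b →
      ‖f (dy m (n+1)) - f (dy m n)‖ ≤ Y * C2 * q ^ m := by
    intro m n h1 h2
    have hn : n + 1 < 2 ^ m := by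
      have : dy m (n+1) < 1 := h2.trans_lt hb1
      unfold dy at this
      rw [div_lt_one (by positivity)] at this
      exact_mod_cast this
    have h3 := rr_bound hC hq0 hq1 hloc hZ hn (Y := Y) fun t ht1 ht2 => hY t (h1.trans ht1) (ht2.trans h2)
    have h4 := dz_le hC hq0 hZ hn
    have h5 : ‖f (dy m n)‖ ≤ Y := hY _ h1 ((dy_mono m (by omega)).trans h2)
    unfold rr at h3
    unfold dz at h4
    have h6 : f (dy m (n+1)) - f (dy m n) = (f (dy m (n+1)) - f (dy m n) - (Z (dy m (n+1)) - Z (dy m n)) * star (f (dy m n)))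
       + (Z (dy m (n+1)) - Z (dy m n)) * star (f (dy m n)) := by ring
    rw [h6]
    refine (norm_add_le _ _).trans ?_
    rw [norm_mul (Z _ - Z _), norm_star]
    have h7 : ‖Z (dy m (n+1)) - Z (dy m n)‖ * ‖f (dy m n)‖ ≤ C * q ^ m * Y := by gcongr
    refine (add_le_add h3 h7).trans (le_of_eq ?_)
    rw [hC2]; ring
  have hdy : ∀ i n, n + 2 ^ i ≥ 2 ^ (m0+i) → dy (m0+i) n ≤ b →
      ‖f (dy (m0+i) n) - f (dy m0 (2^m0-1))‖ ≤ Y * C2 * ∑ l ∈ Finset.range i, q ^ (m0 + l + 1) := by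
    intro i
    induction i with
    | zero =>
      intro n h1 h2
      have hn : n < 2 ^ m0 := by
        have : dy (m0+0) n < 1 := h2.trans_lt hb1
        unfold dy at this
        rw [div_lt_one (by positivity)] at this
        exact_mod_cast this
      have : n = 2^m0-1 := by simp at h1; omega
      simp [this]
    | succ i ih =>
      intro n h1 h2
      rw [Finset.sum_range_succ]
      have hp : 2^(m0+(i+1)) = 2 * 2^(m0+i) := by rw [← add_assoc, pow_succ]; ring
      have hp2 : 2^(i+1) = 2 * 2^i := by rw [pow_succ]; ring
      obtain ⟨k, rfl | rfl⟩ : ∃ k, n = 2*k ∨ n = 2*k+1 := ⟨n/2, by omega⟩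
      · rw [← add_assoc, dy_double] at h2 ⊢
        refine (ih k (by omega) h2).trans ?_
        rw [mul_add]
        have : 0 ≤ Y * C2 * q ^ (m0+i+1) := by positivity
        linarith
      · rw [← add_assoc] at h2 ⊢
        have hk : k + 2^i ≥ 2^(m0+i) := by omega
        have hkb : dy (m0+i) k ≤ b := by
          rw [← dy_double]
          exact (dy_mono _ (by omega)).trans h2
        have h3 := ih k hk hkb
        have h4 := hinc (m0+i+1) (2*k) (by
          rw [dy_double, ← dyl i]
          refine dy_mono _ ?_
          rw [Nat.mul_sub, mul_one, ← pow_add, add_comm i]; omega) h2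
        rw [dy_double] at h4
        calc _ ≤ ‖f (dy (m0+i+1) (2*k+1)) - f (dy (m0+i) k)‖ + ‖f (dy (m0+i) k) - f (dy m0 (2^m0-1))‖ := by
              rw [← dist_eq_norm, ← dist_eq_norm, ← dist_eq_norm]; exact dist_triangle _ _ _
          _ ≤ _ := by linarith
  intro t ht1 ht2
  obtain ⟨K, hK0, hK⟩ := hloc b ((dy_nonneg _ _).trans hb) hb1
  have ht0 : 0 ≤ t := (dy_nonneg _ _).trans ht1
  have hb' : ∀ i : ℕ, ‖f t - f (dy m0 (2^m0-1))‖ ≤ Y * (C2/(1-q)) * q^m0 + K * (1/2)^i := by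
    intro i
    set n := ⌊2^(m0+i) * t⌋₊ with hn
    have hp : (0:ℝ) < 2^(m0+i) := by positivity
    have hn1 : (n:ℝ) ≤ 2^(m0+i) * t := Nat.floor_le (by positivity)
    have hn2 : 2^(m0+i) * t < n + 1 := Nat.lt_floor_add_one _
    have hd1 : dy (m0+i) n ≤ t := by unfold dy; rw [div_le_iff₀ hp]; linarith
    have hd2 : t - dy (m0+i) n ≤ (1/2)^i := by
      have : t - dy (m0+i) n ≤ 1/2^(m0+i) := by
        unfold dy
        rw [sub_le_iff_le_add, ← add_div, le_div_iff₀ hp]; linarith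
      refine this.trans ?_
      rw [div_pow, one_pow]
      gcongr
      · norm_num
      · omega
    have hn3 : n + 2^i ≥ 2^(m0+i) := by
      have : 2^i * (2^m0-1) ≤ n := by
        refine Nat.le_floor ?_
        have h := ht1
        rw [← dyl i] at h
        unfold dy at h
        rw [div_le_iff₀ hp] at h
        linarith
      rw [Nat.mul_sub, mul_one, ← pow_add, add_comm i] at this
      omega
    have h1 := hdy i n hn3 (hd1.trans ht2)
    have h2 := (hK _ t (dy_nonneg (m0+i) n) hd1 ht2).1
    calc _ ≤ ‖f t - f (dy (m0+i) n)‖ + ‖f (dy (m0+i) n) - f (dy m0 (2^m0-1))‖ := by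
              rw [← dist_eq_norm, ← dist_eq_norm, ← dist_eq_norm]; exact dist_triangle _ _ _
      _ ≤ K * (1/2)^i + Y * C2 * (q^m0/(1-q)) := by
          gcongr
          · exact h2.trans (by gcongr)
          · exact h1.trans (by gcongr; exact geom_bound hq0 hq1 m0 i)
      _ = _ := by ring
  have hlim := (tendsto_pow_atTop_nhds_zero_of_lt_one (r := (1/2:ℝ)) (by norm_num) (by norm_num)).const_mul K
  have := ge_of_tendsto (hlim.const_add (Y * (C2/(1-q)) * q^m0)) (Eventually.of_forall hb')
  simpa using this

theorem dy_last (m : ℕ) : dy m (2^m-1) = 1 - (1/2)^m := by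
  unfold dy
  rw [Nat.cast_sub Nat.one_le_two_pow]; push_cast; rw [sub_div, div_self (by positivity)]; simp

theorem young_limit (hC : 0 ≤ C) (hq0 : 0 < q) (hq1 : q < 1)
    (hloc : ∀ b, 0 ≤ b → b < 1 → ∃ K, 0 ≤ K ∧ ∀ a c, 0 ≤ a → a ≤ c → c ≤ b →
      ‖f c - f a‖ ≤ K * (c - a) ∧ ‖f c - f a - (Z c - Z a) * star (f a)‖ ≤ K * (c - a) ^ 2)
    (hZ : ∀ m, ∑ n ∈ Finset.range (2^m - 1), dz Z m n ^ 2 ≤ (C * q ^ m) ^ 2) :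
    ∃ l, Tendsto f (nhdsWithin 1 (Iio 1)) (nhds l) := by
  obtain ⟨C3, hC30, hch⟩ := young_chain hC hq0 hq1 hloc hZ
  have hqlim := tendsto_pow_atTop_nhds_zero_of_lt_one hq0.le hq1
  have key : ∀ m0, C3 * q ^ m0 ≤ 1/2 → ∀ t, dy m0 (2^m0-1) ≤ t → t < 1 →
      ‖f t - f (dy m0 (2^m0-1))‖ ≤ 2 * ‖f (dy m0 (2^m0-1))‖ * (C3 * q ^ m0) := by
    intro m0 hm t ht1 ht2
    have ht00 := dy_nonneg m0 (2^m0-1)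
    obtain ⟨K, hK0, hK⟩ := hloc t (ht00.trans ht1) ht2
    have hcont : ContinuousOn f (Icc (dy m0 (2^m0-1)) t) := by
      refine LipschitzOnWith.continuousOn (K := K.toNNReal) (LipschitzOnWith.of_dist_le_mul fun x hx y hy => ?_)
      rw [Real.coe_toNNReal _ hK0, dist_eq_norm, Real.dist_eq]
      rcases le_total x y with h | h
      · have := (hK x y (ht00.trans hx.1) h hy.2).1
        rw [norm_sub_rev, abs_sub_comm, abs_of_nonneg (by linarith)]; exact this
      · have := (hK y x (ht00.trans hy.1) h hx.2).1
        rw [abs_of_nonneg (by linarith)]; exact this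
    obtain ⟨s, hs, hmax⟩ := isCompact_Icc.exists_isMaxOn (nonempty_Icc.2 ht1) hcont.norm
    have hY : ∀ r, dy m0 (2^m0-1) ≤ r → r ≤ t → ‖f r‖ ≤ ‖f s‖ := fun r h1 h2 => hmax ⟨h1, h2⟩
    have h1 := hch m0 t ‖f s‖ ht1 ht2 hY
    have h2 := h1 s hs.1 hs.2
    have h3 := h1 t ht1 le_rfl
    have h4 : ‖f s‖ ≤ ‖f s - f (dy m0 (2^m0-1))‖ + ‖f (dy m0 (2^m0-1))‖ := by
      simpa using norm_add_le (f s - f (dy m0 (2^m0-1))) (f (dy m0 (2^m0-1)))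
    have h5 : ‖f s‖ * C3 * q^m0 ≤ ‖f s‖ * (1/2) := by
      rw [mul_assoc]; gcongr
    have h6 : ‖f s‖ ≤ 2 * ‖f (dy m0 (2^m0-1))‖ := by linarith
    refine h3.trans ?_
    rw [mul_assoc]
    gcongr
  obtain ⟨m1, hm1⟩ : ∃ m1, ∀ m ≥ m1, C3 * q ^ m ≤ 1/2 := by
    have := (hqlim.const_mul C3).eventually (gt_mem_nhds (show C3 * 0 < 1/2 by norm_num))
    obtain ⟨m1, h⟩ := eventually_atTop.1 this
    exact ⟨m1, fun m hm => (h m hm).le⟩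
  set F := 2 * ‖f (dy m1 (2^m1-1))‖ with hF
  have hFb : ∀ t, dy m1 (2^m1-1) ≤ t → t < 1 → ‖f t‖ ≤ F := by
    intro t h1 h2
    have h3 := key m1 (hm1 m1 le_rfl) t h1 h2
    have h4 : ‖f t‖ ≤ ‖f t - f (dy m1 (2^m1-1))‖ + ‖f (dy m1 (2^m1-1))‖ := by
      simpa using norm_add_le (f t - f (dy m1 (2^m1-1))) (f (dy m1 (2^m1-1)))
    have h5 : 2 * ‖f (dy m1 (2^m1-1))‖ * (C3 * q ^ m1) ≤ 2 * ‖f (dy m1 (2^m1-1))‖ * (1/2) := by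
      gcongr; exact hm1 m1 le_rfl
    linarith
  have hcau : Cauchy (map f (nhdsWithin 1 (Iio 1))) := by
    rw [Metric.cauchy_iff]
    refine ⟨inferInstance, fun ε hε => ?_⟩
    have h1 : Tendsto (fun m => 2 * F * (C3 * q^m)) atTop (nhds 0) := by
      simpa using (hqlim.const_mul C3).const_mul (2*F)
    obtain ⟨m, hm, hmm⟩ := ((h1.eventually (gt_mem_nhds (half_pos hε))).and (eventually_ge_atTop m1)).exists
    have hmono : dy m1 (2^m1-1) ≤ dy m (2^m-1) := by
      rw [dy_last, dy_last]
      have : (1/2:ℝ)^m ≤ (1/2)^m1 := pow_le_pow_of_le_one (by norm_num) (by norm_num) hmm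
      linarith
    have hlt : dy m (2^m-1) < 1 := by
      rw [dy_last]; have : (0:ℝ) < (1/2)^m := by positivity
      linarith
    refine ⟨f '' Ico (dy m (2^m-1)) 1, image_mem_map (Ico_mem_nhdsLT hlt), ?_⟩
    have hd : ∀ t ∈ Ico (dy m (2^m-1)) 1, dist (f t) (f (dy m (2^m-1))) < ε/2 := by
      intro t ht
      rw [dist_eq_norm]
      refine (key m (hm1 m hmm) t ht.1 ht.2).trans_lt (lt_of_le_of_lt ?_ hm)
      gcongr
      exact hFb _ hmono hlt
    rintro _ ⟨x, hx, rfl⟩ _ ⟨y, hy, rfl⟩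
    calc _ ≤ dist (f x) (f (dy m (2^m-1))) + dist (f y) (f (dy m (2^m-1))) := dist_triangle_right _ _ _
      _ < ε := by linarith [hd x hx, hd y hy]
  exact CompleteSpace.complete hcau

end young

theorem byparts_osc {α β s : ℝ} (hs : s ≠ 0) {H H' : ℝ → ℂ}
    (hd : ∀ k ∈ uIcc α β, HasDerivAt H (H' k) k) (hc : ContinuousOn H' (uIcc α β))
    (h0 : H α = 0) (h1 : H β = 0) :
    ∫ k in α..β, H k * Complex.exp (Complex.I * (2 * k * s)) =
      -(1 / (Complex.I * (2 * s))) * ∫ k in α..β, H' k * Complex.exp (Complex.I * (2 * k * s)) := by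
  have hne : Complex.I * (2 * (s:ℂ)) ≠ 0 := by
    simp [hs]
  have hv : ∀ k ∈ uIcc α β, HasDerivAt (fun k : ℝ => (1 / (Complex.I * (2 * (s:ℂ)))) * Complex.exp (Complex.I * (2 * k * s)))
      (Complex.exp (Complex.I * (2 * k * s))) k := by
    intro k _
    have h : HasDerivAt (fun k : ℝ => Complex.I * (2 * (k:ℂ) * s)) (Complex.I * (2 * 1 * s)) k := by
      exact (((hasDerivAt_id k).ofReal_comp.const_mul (2:ℂ)).mul_const (s:ℂ)).const_mul Complex.I
    refine (h.cexp.const_mul (1 / (Complex.I * (2 * (s:ℂ))))).congr_deriv ?_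
    field_simp
    exact div_self (by exact_mod_cast hs)
  have := intervalIntegral.integral_mul_deriv_eq_deriv_mul hd hv hc.intervalIntegrable
    (Continuous.intervalIntegrable (by fun_prop) _ _)
  rw [this, h0, h1]
  simp only [zero_mul, sub_self, zero_sub]
  rw [neg_mul, ← intervalIntegral.integral_const_mul]
  congr 2
  ext k; ring

noncomputable def eta (α β k : ℝ) : ℝ := (k - α) ^ 2 * (β - k) ^ 2
noncomputable def eta1 (α β k : ℝ) : ℝ := 2 * (k - α) * (β - k) ^ 2 - 2 * (k - α) ^ 2 * (β - k)
noncomputable def eta2 (α β k : ℝ) : ℝ := 2 * (β - k) ^ 2 - 8 * (k - α) * (β - k) + 2 * (k - α) ^ 2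

theorem eta_d (α β k : ℝ) : HasDerivAt (fun k => (eta α β k : ℂ)) (eta1 α β k : ℂ) k := by
  refine HasDerivAt.ofReal_comp ?_
  unfold eta eta1
  have h1 := (((hasDerivAt_id k).sub_const α).pow 2).mul (((hasDerivAt_id k).const_sub β).pow 2)
  refine h1.congr_deriv ?_
  simp; ring

theorem eta1_d (α β k : ℝ) : HasDerivAt (fun k => (eta1 α β k : ℂ)) (eta2 α β k : ℂ) k := by
  refine HasDerivAt.ofReal_comp ?_
  unfold eta1 eta2
  have a1 := (hasDerivAt_id k).sub_const α
  have b1 := (hasDerivAt_id k).const_sub β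
  have h1 := ((a1.const_mul 2).mul (b1.pow 2)).sub (((a1.pow 2).const_mul 2).mul b1)
  refine h1.congr_deriv ?_
  simp; ring

theorem EE_d (D : ℝ) {k : ℝ} (hk : k ≠ 0) :
    HasDerivAt (fun k : ℝ => Complex.exp (Complex.I * (-(D / k))))
      (Complex.I * D * ((k⁻¹ ^ 2 : ℝ) : ℂ) * Complex.exp (Complex.I * (-(D / k)))) k := by
  have h := (hasDerivAt_inv hk).ofReal_comp
  have h2 := (((h.const_mul (D:ℂ)).neg).const_mul Complex.I).cexp
  have e : (fun k : ℝ => Complex.exp (Complex.I * (-(D / k)))) = fun k : ℝ => Complex.exp (Complex.I * -((D:ℂ) * ((k⁻¹ : ℝ) : ℂ))) := by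
    ext k; simp [div_eq_mul_inv]
  rw [e]
  have h3 : Complex.exp (Complex.I * (-(D / k))) = Complex.exp (Complex.I * -((D:ℂ) * ((k⁻¹ : ℝ) : ℂ))) := by
    simp [div_eq_mul_inv]
  rw [h3]
  refine h2.congr_deriv ?_
  push_cast
  simp only [Pi.neg_apply]
  push_cast
  ring

theorem EE_norm (D k : ℝ) : ‖Complex.exp (Complex.I * (-(D / k)))‖ = 1 := by
  have : Complex.I * (-((D:ℂ) / k)) = ((-(D/k) : ℝ) : ℂ) * Complex.I := by push_cast; ring
  rw [this, Complex.norm_exp_ofReal_mul_I]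

theorem ks_norm (s k : ℝ) : ‖Complex.exp (Complex.I * (2 * k * s))‖ = 1 := by
  have : Complex.I * (2 * (k:ℂ) * s) = ((2 * k * s : ℝ) : ℂ) * Complex.I := by push_cast; ring
  rw [this, Complex.norm_exp_ofReal_mul_I]

noncomputable def kap (α β s D : ℝ) : ℂ :=
  ∫ k in α..β, (eta α β k * Complex.exp (Complex.I * (-(D / k)))) * Complex.exp (Complex.I * (2 * k * s))

theorem kap_bound {α β : ℝ} (hα : 0 < α) (hαβ : α < β) :
    ∃ C, 0 ≤ C ∧ ∀ s D, ‖kap α β s D‖ ≤ C ∧ (s ≠ 0 → ‖kap α β s D‖ ≤ C * (1 + D ^ 2) / s ^ 2) := by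
  have c0 : Continuous (eta α β) := by unfold eta; fun_prop
  have c1 : Continuous (eta1 α β) := by unfold eta1; fun_prop
  have c2 : Continuous (eta2 α β) := by unfold eta2; fun_prop
  obtain ⟨M0, hM0⟩ := (isCompact_uIcc (a := α) (b := β)).exists_bound_of_continuousOn c0.continuousOn
  obtain ⟨M1, hM1⟩ := (isCompact_uIcc (a := α) (b := β)).exists_bound_of_continuousOn c1.continuousOn
  obtain ⟨M2, hM2⟩ := (isCompact_uIcc (a := α) (b := β)).exists_bound_of_continuousOn c2.continuousOn
  have p0 : 0 ≤ M0 := (norm_nonneg _).trans (hM0 α (by simp))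
  have p1 : 0 ≤ M1 := (norm_nonneg _).trans (hM1 α (by simp))
  have p2 : 0 ≤ M2 := (norm_nonneg _).trans (hM2 α (by simp))
  have hl : 0 < β - α := by linarith
  set i := α⁻¹ with hi
  have pi : 0 < i := inv_pos.2 hα
  set B := M2 + 2 * M1 * i^2 + 2 * M0 * i^3 + M0 * i^4 with hB
  have pB : 0 ≤ B := by positivity
  have hpos : ∀ k ∈ uIcc α β, 0 < k ∧ k⁻¹ ≤ i := by
    intro k hk
    rw [uIcc_of_le hαβ.le] at hk
    exact ⟨hα.trans_le hk.1, inv_anti₀ hα hk.1⟩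
  refine ⟨(M0 + B) * (β - α), by positivity, fun s D => ⟨?_, fun hs => ?_⟩⟩
  · unfold kap
    refine (intervalIntegral.norm_integral_le_of_norm_le_const (C := M0 + B) fun k hk => ?_).trans ?_
    · rw [norm_mul, norm_mul, EE_norm, ks_norm, Complex.norm_real, mul_one, mul_one]
      linarith [hM0 k (uIoc_subset_uIcc hk)]
    · rw [abs_of_pos hl]
  · set H1 : ℝ → ℂ := fun k => (eta1 α β k + Complex.I * D * ((k⁻¹ ^ 2 : ℝ) : ℂ) * eta α β k) * Complex.exp (Complex.I * (-(D / k))) with hH1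
    set H2 : ℝ → ℂ := fun k => (eta2 α β k + 2 * (Complex.I * D * ((k⁻¹ ^ 2 : ℝ) : ℂ)) * eta1 α β k
      - 2 * (Complex.I * D * ((k⁻¹ ^ 3 : ℝ) : ℂ)) * eta α β k - D^2 * ((k⁻¹ ^ 4 : ℝ) : ℂ) * eta α β k) * Complex.exp (Complex.I * (-(D / k))) with hH2
    have d1 : ∀ k ∈ uIcc α β, HasDerivAt (fun k : ℝ => (eta α β k : ℂ) * Complex.exp (Complex.I * (-(D / k)))) (H1 k) k := by
      intro k hk
      refine ((eta_d α β k).mul (EE_d D (hpos k hk).1.ne')).congr_deriv ?_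
      rw [hH1]; ring
    have dinv : ∀ k ∈ uIcc α β, HasDerivAt (fun k : ℝ => ((k⁻¹ ^ 2 : ℝ) : ℂ)) ((-2 * k⁻¹ ^ 3 : ℝ) : ℂ) k := by
      intro k hk
      have hk0 := (hpos k hk).1.ne'
      refine HasDerivAt.ofReal_comp ?_
      refine ((hasDerivAt_inv hk0).pow 2).congr_deriv ?_
      simp; field_simp
    have d2 : ∀ k ∈ uIcc α β, HasDerivAt H1 (H2 k) k := by
      intro k hk
      have := ((eta1_d α β k).add (((dinv k hk).const_mul (Complex.I * D)).mul (eta_d α β k))).mul (EE_d D (hpos k hk).1.ne')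
      refine this.congr_deriv ?_
      rw [hH2]
      have : Complex.I ^ 2 = -1 := Complex.I_sq
      push_cast
      simp only [Pi.add_apply, Pi.mul_apply]
      push_cast
      ring_nf
      rw [this]; ring
    have cinv : ContinuousOn (fun k : ℝ => k⁻¹) (uIcc α β) :=
      continuousOn_inv₀.mono fun k hk => (hpos k hk).1.ne'
    have cE : ContinuousOn (fun k : ℝ => Complex.exp (Complex.I * (-(D / k)))) (uIcc α β) :=
      fun k hk => (EE_d D (hpos k hk).1.ne').continuousAt.continuousWithinAt
    have cinvn : ∀ n : ℕ, ContinuousOn (fun k : ℝ => ((k⁻¹ ^ n : ℝ) : ℂ)) (uIcc α β) := fun n =>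
      Complex.continuous_ofReal.comp_continuousOn (cinv.pow n)
    have cc0 : Continuous (fun k => (eta α β k : ℂ)) := by fun_prop
    have cc1 : Continuous (fun k => (eta1 α β k : ℂ)) := by fun_prop
    have cc2 : Continuous (fun k => (eta2 α β k : ℂ)) := by fun_prop
    have cH1 : ContinuousOn H1 (uIcc α β) := fun k hk => (d2 k hk).continuousAt.continuousWithinAt
    have cH2 : ContinuousOn H2 (uIcc α β) := by
      refine ContinuousOn.mul (((cc2.continuousOn.add ?_).sub ?_).sub ?_) cE
      · exact ((continuousOn_const.mul (cinvn 2)).const_mul _ |>.mul cc1.continuousOn)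
      · exact ((continuousOn_const.mul (cinvn 3)).const_mul _ |>.mul cc0.continuousOn)
      · exact ((continuousOn_const.mul (cinvn 4)).mul cc0.continuousOn)
    have e1 := byparts_osc hs d1 cH1 (by simp [eta]) (by simp [eta])
    have e2 := byparts_osc hs d2 cH2 (by simp [hH1, eta, eta1]) (by simp [hH1, eta, eta1])
    unfold kap
    rw [e1, e2, norm_mul, norm_mul]
    have nn : ‖-(1 / (Complex.I * (2 * (s:ℂ))))‖ = 1 / (2 * |s|) := by
      simp
    have hH2b : ∀ k ∈ uIcc α β, ‖H2 k‖ ≤ B * (1 + D^2) := by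
      intro k hk
      rw [hH2]
      simp only []
      rw [norm_mul, EE_norm, mul_one]
      have hk1 := (hpos k hk).1
      have hk2 := (hpos k hk).2
      have hk3 : 0 < k⁻¹ := inv_pos.2 hk1
      have q0 := hM0 k hk
      have q1 := hM1 k hk
      have q2 := hM2 k hk
      have hD : |D| ≤ 1 + D^2 := by
        rw [← sq_abs D]; nlinarith [sq_nonneg (|D| - 1), abs_nonneg D]
      have hD1 : (1:ℝ) ≤ 1 + D^2 := by nlinarith [sq_nonneg D]
      have hD2 : D^2 ≤ 1 + D^2 := by linarith
      have hD3 : 0 ≤ 1 + D^2 := by positivity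
      refine (norm_sub_le _ _).trans ?_
      refine (add_le_add ((norm_sub_le _ _).trans (add_le_add (norm_add_le _ _) le_rfl)) le_rfl).trans ?_
      simp only [norm_mul, norm_pow, Complex.norm_I, Complex.norm_real, Complex.norm_ofNat, one_mul]
      have nk : ∀ n : ℕ, ‖k⁻¹‖ ^ n ≤ i ^ n := fun n => by
        rw [Real.norm_eq_abs, abs_of_pos hk3]; gcongr
      have nD : ‖D‖ ≤ 1 + D^2 := hD
      have nD2 : ‖D‖^2 ≤ 1 + D^2 := by rw [Real.norm_eq_abs, sq_abs]; exact hD2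
      calc _ ≤ M2 * (1 + D^2) + 2 * ((1 + D^2) * i^2) * M1 + 2 * ((1 + D^2) * i^3) * M0 + (1 + D^2) * i^4 * M0 := by
            gcongr
            · nlinarith
            · simpa using nk 1
            · simpa using nk 1
            · simpa using nk 1
        _ = _ := by rw [hB]; ring
    have hI : ‖∫ k in α..β, H2 k * Complex.exp (Complex.I * (2 * k * s))‖ ≤ B * (1 + D^2) * (β - α) := by
      rw [← abs_of_pos hl]
      refine intervalIntegral.norm_integral_le_of_norm_le_const fun k hk => ?_
      rw [norm_mul, ks_norm, mul_one]
      exact hH2b k (uIoc_subset_uIcc hk)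
    rw [nn]
    have hs2 : 0 < |s| := abs_pos.2 hs
    calc _ ≤ 1 / (2 * |s|) * (1 / (2 * |s|) * (B * (1 + D^2) * (β - α))) := by gcongr
      _ = (B * (β - α) * (1 + D^2)) / s^2 * (1/4) := by rw [← sq_abs s]; field_simp; ring
      _ ≤ ((M0 + B) * (β - α) * (1 + D^2)) / s^2 * 1 := by gcongr <;> linarith
      _ = _ := by ring

theorem hls_kernel {p : ℝ} (hp1 : 1 ≤ p) (hp2 : p < 2) {H K : ℝ → ENNReal} (hH : Measurable H)
    (hK : Measurable K) (hK1 : ∀ s, K s ≤ 1) {μ : Measure ℝ} [SFinite μ] (hμ : μ ≤ volume) :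
    ∫⁻ z, H z.1 * H z.2 * K (z.1 - z.2) ∂(μ.prod μ) ≤
      (∫⁻ x, H x ^ p ∂μ) ^ (2 / p) * (∫⁻ s, K s) ^ (2 * (1 - 1 / p)) := by
  have hp0 : 0 < p := by linarith
  set a := 2 / p - 1 with ha
  set b := 1 - 1 / p with hb
  have ha0 : 0 ≤ a := by
    rw [ha, sub_nonneg, le_div_iff₀ hp0]; linarith
  have hb0 : 0 ≤ b := by
    rw [hb, sub_nonneg, div_le_one hp0]; linarith
  have hab : a + b = 1 / p := by rw [ha, hb]; ring
  have hab2 : a + b + b = 1 := by rw [ha, hb]; ring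
  have hpt : ∀ z : ℝ × ℝ, H z.1 * H z.2 * K (z.1 - z.2) ≤
      ∏ i ∈ (Finset.univ : Finset (Fin 3)), (![fun z : ℝ × ℝ => H z.1 ^ p * H z.2 ^ p,
        fun z : ℝ × ℝ => H z.1 ^ p * K (z.1 - z.2), fun z : ℝ × ℝ => H z.2 ^ p * K (z.1 - z.2)] i) z ^ (![a, b, b] i) := by
    intro z
    rw [Fin.prod_univ_three]
    simp only [Matrix.cons_val_zero, Matrix.cons_val_one, Matrix.cons_val]
    rw [ENNReal.mul_rpow_of_nonneg _ _ ha0, ENNReal.mul_rpow_of_nonneg _ _ hb0, ENNReal.mul_rpow_of_nonneg _ _ hb0]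
    have e : ∀ h : ENNReal, h = (h ^ p) ^ a * (h ^ p) ^ b := by
      intro h
      rw [← ENNReal.rpow_add_of_nonneg _ _ ha0 hb0, hab, ← ENNReal.rpow_mul, mul_one_div_cancel hp0.ne', ENNReal.rpow_one]
    have hKK : K (z.1 - z.2) ≤ K (z.1 - z.2) ^ b * K (z.1 - z.2) ^ b := by
      rw [← ENNReal.rpow_add_of_nonneg _ _ hb0 hb0]
      nth_rw 1 [← ENNReal.rpow_one (K (z.1 - z.2))]
      exact ENNReal.rpow_le_rpow_of_exponent_ge (hK1 _) (by linarith)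
    calc H z.1 * H z.2 * K (z.1 - z.2) ≤ ((H z.1 ^ p) ^ a * (H z.1 ^ p) ^ b) * ((H z.2 ^ p) ^ a * (H z.2 ^ p) ^ b) * (K (z.1 - z.2) ^ b * K (z.1 - z.2) ^ b) := by
          rw [← e, ← e]; gcongr
      _ = _ := by ring
  refine (lintegral_mono hpt).trans ?_
  have mH1 : Measurable fun z : ℝ × ℝ => H z.1 ^ p := (hH.comp measurable_fst).pow_const p
  have mH2 : Measurable fun z : ℝ × ℝ => H z.2 ^ p := (hH.comp measurable_snd).pow_const p
  have mK : Measurable fun z : ℝ × ℝ => K (z.1 - z.2) := hK.comp (measurable_fst.sub measurable_snd)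
  refine (ENNReal.lintegral_prod_norm_pow_le Finset.univ ?_ ?_ ?_).trans ?_
  · intro i _
    fin_cases i
    · exact (mH1.mul mH2).aemeasurable
    · exact (mH1.mul mK).aemeasurable
    · exact (mH2.mul mK).aemeasurable
  · rw [Fin.sum_univ_three]; simpa using hab2
  · intro i _
    fin_cases i
    · exact ha0
    · exact hb0
    · exact hb0
  rw [Fin.prod_univ_three]
  simp only [Matrix.cons_val_zero, Matrix.cons_val_one, Matrix.cons_val]
  set S := ∫⁻ x, H x ^ p ∂μ with hS
  set T := ∫⁻ s, K s with hT
  have i1 : ∫⁻ z, H z.1 ^ p * H z.2 ^ p ∂(μ.prod μ) = S * S :=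
    lintegral_prod_mul (hH.pow_const p).aemeasurable (hH.pow_const p).aemeasurable
  have i2 : ∫⁻ z, H z.1 ^ p * K (z.1 - z.2) ∂(μ.prod μ) ≤ S * T := by
    rw [lintegral_prod (fun z : ℝ × ℝ => H z.1 ^ p * K (z.1 - z.2)) (mH1.mul mK).aemeasurable, hS, ← lintegral_mul_const _ (hH.pow_const p)]
    refine lintegral_mono fun x => ?_
    simp only
    rw [lintegral_const_mul _ (by fun_prop)]
    gcongr
    exact (lintegral_mono' hμ le_rfl).trans (lintegral_sub_left_eq_self K x).le
  have i3 : ∫⁻ z, H z.2 ^ p * K (z.1 - z.2) ∂(μ.prod μ) ≤ S * T := by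
    rw [lintegral_prod_symm (fun z : ℝ × ℝ => H z.2 ^ p * K (z.1 - z.2)) (mH2.mul mK).aemeasurable, hS, ← lintegral_mul_const _ (hH.pow_const p)]
    refine lintegral_mono fun x => ?_
    simp only
    rw [lintegral_const_mul _ (by fun_prop)]
    gcongr
    exact (lintegral_mono' hμ le_rfl).trans (lintegral_sub_right_eq_self K x).le
  rw [i1]
  calc _ ≤ (S * S) ^ a * (S * T) ^ b * (S * T) ^ b := by gcongr
    _ = (S ^ a * S ^ b) * (S ^ a * S ^ b) * (T ^ b * T ^ b) := by
      rw [ENNReal.mul_rpow_of_nonneg _ _ ha0, ENNReal.mul_rpow_of_nonneg _ _ hb0]; ring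
    _ = S ^ (2 / p) * T ^ (2 * b) := by
      rw [← ENNReal.rpow_add_of_nonneg _ _ ha0 hb0, ← ENNReal.rpow_add_of_nonneg _ _ hb0 hb0, hab,
        ← ENNReal.rpow_add_of_nonneg _ _ (by positivity) (by positivity)]
      congr 2 <;> ring
    _ ≤ _ := le_rfl

theorem W_holder {p : ℝ} (hp1 : 1 ≤ p) {V : ℝ → ℝ} (hmeas : Measurable V)
    (hloc : LocallyIntegrable V) (hLp : Integrable (fun x => |V x| ^ p)) :
    ∃ N, 0 ≤ N ∧ ∀ x y, |(∫ t in (0:ℝ)..x, V t) - ∫ t in (0:ℝ)..y, V t| ≤ N * |x - y| ^ (1 - 1 / p) := by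
  have hp0 : 0 < p := by linarith
  have hb0 : 0 ≤ 1 - 1 / p := by
    rw [sub_nonneg, div_le_one hp0]; linarith
  set S := ∫⁻ x, ENNReal.ofReal (|V x| ^ p) with hS
  have hSf : S ≠ ⊤ := by
    have := hLp.lintegral_lt_top
    exact this.ne
  have hSf' : S ^ (1 / p) ≠ ⊤ := ENNReal.rpow_ne_top_of_nonneg (by positivity) hSf
  refine ⟨(S ^ (1/p)).toReal, ENNReal.toReal_nonneg, ?_⟩
  intro x y
  have hii : ∀ a b, IntervalIntegrable V volume a b := fun a b => (hloc.integrableOn_isCompact isCompact_uIcc).intervalIntegrable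
  rw [intervalIntegral.integral_interval_sub_left (hii _ _) (hii _ _)]
  rw [← Real.norm_eq_abs, intervalIntegral.norm_integral_eq_norm_integral_uIoc]
  have h1 : ‖∫ t in uIoc y x, V t‖ₑ ≤ S ^ (1/p) * (ENNReal.ofReal |x - y|) ^ (1 - 1/p) := by
    refine (enorm_integral_le_lintegral_enorm _).trans ?_
    have : ∀ t, ‖V t‖ₑ = ENNReal.ofReal (|V t| ^ p) ^ (1/p) * (1 : ENNReal) ^ (1 - 1/p) := by
      intro t
      rw [ENNReal.one_rpow, mul_one, ENNReal.ofReal_rpow_of_nonneg (by positivity) (by positivity),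
        ← Real.rpow_mul (abs_nonneg _), mul_one_div_cancel hp0.ne', Real.rpow_one, ← Real.norm_eq_abs, ofReal_norm]
    simp_rw [this]
    refine (ENNReal.lintegral_mul_norm_pow_le (by fun_prop) (by fun_prop) (by positivity) hb0 (by ring)).trans ?_
    gcongr
    · exact setLIntegral_le_lintegral _ _
    · rw [lintegral_const, one_mul, Measure.restrict_apply_univ]
      rw [Set.uIoc, Real.volume_Ioc, max_sub_min_eq_abs]
  have h2 := ENNReal.toReal_mono (ENNReal.mul_ne_top hSf' (ENNReal.rpow_ne_top_of_nonneg hb0 ENNReal.ofReal_ne_top)) h1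
  rw [toReal_enorm, ENNReal.toReal_mul, ← ENNReal.toReal_rpow (ENNReal.ofReal _), ENNReal.toReal_ofReal (abs_nonneg _)] at h2
  exact h2

theorem kap_kernel {p : ℝ} (hp1 : 1 ≤ p) {V : ℝ → ℝ} (hmeas : Measurable V)
    (hloc : LocallyIntegrable V) (hLp : Integrable (fun x => |V x| ^ p)) {α β : ℝ} (hα : 0 < α) (hαβ : α < β) :
    ∃ C, 0 ≤ C ∧ ∀ x y, ‖kap α β (x - y) ((∫ t in (0:ℝ)..x, V t) - ∫ t in (0:ℝ)..y, V t)‖ ≤ C * (1 + ‖x - y‖) ^ (-(2 / p)) := by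
  obtain ⟨N, hN, hNb⟩ := W_holder hp1 hmeas hloc hLp
  obtain ⟨C, hC, hCb⟩ := kap_bound hα hαβ
  have hp0 : 0 < p := by linarith
  have hb0 : 0 ≤ 1 - 1 / p := by
    rw [sub_nonneg, div_le_one hp0]; linarith
  have h2p : 2 / p ≤ 2 := by rw [div_le_iff₀ hp0]; linarith
  have h2p0 : 0 ≤ 2 / p := by positivity
  refine ⟨4 * (C * (1 + N ^ 2)), by positivity, fun x y => ?_⟩
  set s := x - y with hs
  set D := (∫ t in (0:ℝ)..x, V t) - ∫ t in (0:ℝ)..y, V t with hD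
  have hDb : |D| ≤ N * |s| ^ (1 - 1 / p) := hNb x y
  rw [Real.norm_eq_abs s]
  rcases le_total |s| 1 with h | h
  · refine (hCb s D).1.trans ?_
    have : (1/4 : ℝ) ≤ (1 + |s|) ^ (-(2/p)) := by
      rw [Real.rpow_neg (by positivity), one_div]
      apply inv_anti₀ (by positivity)
      calc (1 + |s|) ^ (2/p) ≤ 2 ^ (2/p) := by gcongr; linarith
        _ ≤ 2 ^ (2:ℝ) := Real.rpow_le_rpow_of_exponent_le (by norm_num) h2p
        _ = 4 := by norm_num
    calc C ≤ 4 * (C * (1 + N^2)) * (1/4) := by nlinarith [mul_nonneg hC (sq_nonneg N)]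
      _ ≤ _ := by gcongr
  · have hs0 : 0 < |s| := by linarith
    refine ((hCb s D).2 (abs_pos.1 hs0)).trans ?_
    have hD2 : D ^ 2 ≤ N ^ 2 * |s| ^ (2 - 2/p) := by
      rw [← sq_abs D]
      calc |D|^2 ≤ (N * |s| ^ (1 - 1 / p))^2 := by gcongr
        _ = N ^ 2 * |s| ^ (2 - 2/p) := by
          rw [mul_pow, ← Real.rpow_natCast (|s| ^ (1 - 1 / p)) 2, ← Real.rpow_mul hs0.le]
          congr 2; push_cast; ring
    have h1 : 1 ≤ |s| ^ (2 - 2/p) := Real.one_le_rpow h (by linarith)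
    have h3 : (1 + |s|) ^ (2/p) ≤ 4 * |s| ^ (2/p) := by
      calc (1 + |s|) ^ (2/p) ≤ (2 * |s|) ^ (2/p) := by gcongr; linarith
        _ = 2 ^ (2/p) * |s| ^ (2/p) := Real.mul_rpow (by norm_num) hs0.le
        _ ≤ 2 ^ (2:ℝ) * |s| ^ (2/p) := by gcongr; norm_num
        _ = _ := by norm_num
    have h4 : |s| ^ (-(2/p)) ≤ 4 * (1 + |s|) ^ (-(2/p)) := by
      rw [Real.rpow_neg hs0.le, Real.rpow_neg (by positivity)]
      have q1 : 0 < |s| ^ (2/p) := by positivity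
      have q2 : 0 < (1 + |s|) ^ (2/p) := by positivity
      rw [inv_le_iff_one_le_mul₀ q1, mul_assoc, mul_comm _ (|s| ^ (2/p)), ← mul_assoc, ← div_eq_mul_inv, le_div_iff₀ q2]
      linarith
    calc C * (1 + D^2) / s^2 ≤ C * ((1 + N^2) * |s| ^ (2 - 2/p)) / |s|^2 := by
          rw [sq_abs]; gcongr; nlinarith
      _ = C * (1 + N^2) * |s| ^ (-(2/p)) := by
        rw [show 2 - 2/p = -(2/p) + (2:ℕ) by push_cast; ring, Real.rpow_add_natCast hs0.ne']
        field_simp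
      _ ≤ C * (1 + N^2) * (4 * (1 + |s|) ^ (-(2/p))) := by gcongr
      _ = _ := by ring

noncomputable def gX (V : ℝ → ℝ) (k x : ℝ) : ℂ :=
  (V x : ℂ) * Complex.exp (Complex.I * ((2 * k * x - (∫ t in (0:ℝ)..x, V t) / k : ℝ) : ℂ))

theorem gX_meas {V : ℝ → ℝ} (hmeas : Measurable V) (hloc : LocallyIntegrable V) :
    Measurable (fun z : ℝ × ℝ => gX V z.1 z.2) := by
  have hW : Continuous fun x => ∫ t in (0:ℝ)..x, V t :=
    intervalIntegral.continuous_primitive (fun a b => locInt_ii hloc a b) 0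
  have hWm := hW.measurable
  unfold gX
  fun_prop

theorem gX_norm (V : ℝ → ℝ) (k x : ℝ) : ‖gX V k x‖ = ‖V x‖ := by
  unfold gX
  rw [norm_mul, mul_comm Complex.I, Complex.norm_exp_ofReal_mul_I, Complex.norm_real, mul_one]

theorem gX_mul (V : ℝ → ℝ) (k x y : ℝ) :
    gX V k x * star (gX V k y) = ((V x * V y : ℝ) : ℂ) * (Complex.exp (Complex.I * (-((((∫ t in (0:ℝ)..x, V t) - ∫ t in (0:ℝ)..y, V t : ℝ) : ℂ) / k)))
      * Complex.exp (Complex.I * (2 * k * ((x - y : ℝ) : ℂ)))) := by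
  unfold gX
  simp only [Complex.star_def, map_mul, Complex.conj_ofReal, ← Complex.exp_conj, Complex.conj_I]
  rw [← Complex.exp_add]
  push_cast
  rw [mul_mul_mul_comm, ← Complex.exp_add]
  congr 2
  ring

theorem L2est {p : ℝ} (hp1 : 1 ≤ p) (hp2 : p < 2) {V : ℝ → ℝ} (hmeas : Measurable V)
    (hloc : LocallyIntegrable V) (hLp : Integrable (fun x => |V x| ^ p)) {α β : ℝ} (hα : 0 < α) (hαβ : α < β) :
    ∃ C : ENNReal, C ≠ ⊤ ∧ ∀ a b : ℝ,
      ∫⁻ k in Ioc α β, ENNReal.ofReal (eta α β k * ‖∫ x in Ioc a b, gX V k x‖ ^ 2) ≤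
        C * (∫⁻ x in Ioc a b, ENNReal.ofReal (|V x| ^ p)) ^ (2 / p) := by
  obtain ⟨C, hC, hCb⟩ := kap_kernel hp1 hmeas hloc hLp hα hαβ
  have hp0 : 0 < p := by linarith
  set K : ℝ → ENNReal := fun s => ENNReal.ofReal ((1 + ‖s‖) ^ (-(2 / p))) with hK
  have hKm : Measurable K := by rw [hK]; fun_prop
  have hK1 : ∀ s, K s ≤ 1 := fun s => by
    rw [hK]; simp only
    rw [← ENNReal.ofReal_one]
    apply ENNReal.ofReal_le_ofReal
    apply Real.rpow_le_one_of_one_le_of_nonpos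
    · linarith [norm_nonneg s]
    · simp; positivity
  have hKi : ∫⁻ s, K s ≠ ⊤ := by
    have := (integrable_one_add_norm (E := ℝ) (μ := volume) (r := 2 / p) (by
      simp; rw [lt_div_iff₀ hp0]; linarith)).lintegral_lt_top
    exact this.ne
  have hb0 : 0 ≤ 1 - 1 / p := by
    rw [sub_nonneg, div_le_one hp0]; linarith
  refine ⟨ENNReal.ofReal C * (∫⁻ s, K s) ^ (2 * (1 - 1 / p)),
    ENNReal.mul_ne_top ENNReal.ofReal_ne_top (ENNReal.rpow_ne_top_of_nonneg (by positivity) hKi), fun a b => ?_⟩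
  set μ := volume.restrict (Ioc a b) with hμ
  set ν := volume.restrict (Ioc α β) with hν
  have hVi : Integrable V μ := (locInt_ii hloc a b).1
  set F : ℝ → ℝ × ℝ → ℂ := fun k z => eta α β k * (gX V k z.1 * star (gX V k z.2)) with hF
  have hg := gX_meas hmeas hloc
  have c0 : Continuous (eta α β) := by unfold eta; fun_prop
  have hFm : Measurable (Function.uncurry F) := by
    rw [hF]
    have e1 : Measurable fun q : ℝ × ℝ × ℝ => gX V q.1 q.2.1 := hg.comp (by fun_prop : Measurable fun q : ℝ × ℝ × ℝ => (q.1, q.2.1))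
    have e2 : Measurable fun q : ℝ × ℝ × ℝ => gX V q.1 q.2.2 := hg.comp (by fun_prop : Measurable fun q : ℝ × ℝ × ℝ => (q.1, q.2.2))
    have e3 := c0.measurable
    have e4 : Measurable fun q : ℝ × ℝ × ℝ => star (gX V q.1 q.2.2) := continuous_star.measurable.comp e2
    exact Measurable.mul (by fun_prop) (e1.mul e4)
  have hFi : Integrable (Function.uncurry F) (ν.prod (μ.prod μ)) := by
    have i1 : Integrable (eta α β) ν := (c0.integrableOn_Icc).mono_set Ioc_subset_Icc_self
    have i2 := i1.mul_prod (hVi.mul_prod hVi)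
    refine i2.mono hFm.aestronglyMeasurable (ae_of_all _ fun q => ?_)
    simp only [Function.uncurry, hF, norm_mul, norm_star, gX_norm, Complex.norm_real]
    rfl
  have hX : ∀ k, ∫ z, F k z ∂(μ.prod μ) = ((eta α β k * ‖∫ x, gX V k x ∂μ‖ ^ 2 : ℝ) : ℂ) := by
    intro k
    rw [hF]; simp only
    rw [integral_const_mul, integral_prod_mul (fun x => gX V k x) (fun y => star (gX V k y))]
    have : ∫ y, star (gX V k y) ∂μ = star (∫ y, gX V k y ∂μ) := integral_conj
    rw [this, Complex.star_def, Complex.mul_conj']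
    push_cast; rfl
  have hint : Integrable (fun k => eta α β k * ‖∫ x, gX V k x ∂μ‖ ^ 2) ν := by
    have := hFi.integral_prod_left.re
    refine this.congr (ae_of_all _ fun k => ?_)
    have h := hX k
    show RCLike.re (∫ z, F k z ∂(μ.prod μ)) = _
    rw [h]; rfl
  have hswap : ∫ k, ∫ z, F k z ∂(μ.prod μ) ∂ν = ∫ z, ((V z.1 * V z.2 : ℝ) : ℂ) * kap α β (z.1 - z.2) ((∫ t in (0:ℝ)..z.1, V t) - ∫ t in (0:ℝ)..z.2, V t) ∂(μ.prod μ) := by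
    rw [integral_integral_swap hFi]
    congr 1
    ext z
    unfold kap
    rw [intervalIntegral.integral_of_le hαβ.le, ← integral_const_mul]
    congr 1
    ext k
    simp only [hF, gX_mul]
    ring
  have h0 : ∀ k, 0 ≤ eta α β k * ‖∫ x, gX V k x ∂μ‖ ^ 2 := fun k => by unfold eta; positivity
  rw [← ofReal_integral_eq_lintegral_ofReal hint (ae_of_all _ h0)]
  have hre : ENNReal.ofReal (∫ k, eta α β k * ‖∫ x, gX V k x ∂μ‖ ^ 2 ∂ν) = ‖∫ k, ∫ z, F k z ∂(μ.prod μ) ∂ν‖ₑ := by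
    simp_rw [hX]
    rw [integral_complex_ofReal, ← ofReal_norm, Complex.norm_real, Real.norm_of_nonneg (integral_nonneg h0)]
  rw [hre, hswap]
  refine (enorm_integral_le_lintegral_enorm _).trans ?_
  have hpt : ∀ z : ℝ × ℝ, ‖((V z.1 * V z.2 : ℝ) : ℂ) * kap α β (z.1 - z.2) ((∫ t in (0:ℝ)..z.1, V t) - ∫ t in (0:ℝ)..z.2, V t)‖ₑ
      ≤ ENNReal.ofReal C * (‖V z.1‖ₑ * ‖V z.2‖ₑ * K (z.1 - z.2)) := by
    intro z
    simp only [hK]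
    rw [← ofReal_norm, ← ofReal_norm, ← ofReal_norm, ← ENNReal.ofReal_mul (norm_nonneg _), ← ENNReal.ofReal_mul (by positivity),
      ← ENNReal.ofReal_mul hC]
    apply ENNReal.ofReal_le_ofReal
    rw [norm_mul, Complex.norm_real, norm_mul]
    calc _ ≤ ‖V z.1‖ * ‖V z.2‖ * (C * (1 + ‖z.1 - z.2‖) ^ (-(2 / p))) := by
          gcongr; exact hCb _ _
      _ = _ := by ring
  refine (lintegral_mono hpt).trans ?_
  rw [lintegral_const_mul' _ _ ENNReal.ofReal_ne_top, mul_assoc]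
  gcongr
  refine (hls_kernel hp1 hp2 hmeas.enorm hKm hK1 Measure.restrict_le_self).trans ?_
  rw [mul_comm]
  gcongr with x
  apply le_of_eq
  rw [← ofReal_norm, ENNReal.ofReal_rpow_of_nonneg (norm_nonneg _) hp0.le, Real.norm_eq_abs]

theorem repar {p : ℝ} (hp1 : 1 ≤ p) {V : ℝ → ℝ} 
    (hloc : LocallyIntegrable V) (hLp : Integrable (fun x => |V x| ^ p)) :
    ∃ s τ : ℝ → ℝ, ∃ T : ℝ, 0 ≤ T ∧ (∀ t, 0 ≤ t → t < 1 → 0 ≤ s t) ∧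
      (∀ a c, 0 ≤ a → a ≤ c → c < 1 → s a ≤ s c) ∧
      (∀ x, 0 ≤ x → s (τ x) = x) ∧
      Tendsto τ atTop (nhdsWithin 1 (Iio 1)) ∧
      (∀ b, 0 ≤ b → b < 1 → ∃ K, 0 ≤ K ∧ ∀ a c, 0 ≤ a → a ≤ c → c ≤ b → ∫ x in (s a)..(s c), |V x| ≤ K * (c - a)) ∧
      (∀ a c, 0 ≤ a → a ≤ c → c < 1 → ∫⁻ x in Ioc (s a) (s c), ENNReal.ofReal (|V x| ^ p) ≤ ENNReal.ofReal (T * (c - a))) := by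
  set w : ℝ → ℝ := fun x => |V x| ^ p + (1 + x ^ 2)⁻¹ with hw
  have hwi : Integrable w := hLp.add integrable_inv_one_add_sq
  have hwpos : ∀ x, 0 < w x := fun x => by rw [hw]; positivity
  have hii : ∀ a b, IntervalIntegrable w volume a b := fun a b => hwi.intervalIntegrable
  set A : ℝ → ℝ := fun x => ∫ t in (0:ℝ)..x, w t with hA
  have hAc : Continuous A := intervalIntegral.continuous_primitive hii 0
  have hAsub : ∀ x y, A y - A x = ∫ t in x..y, w t := fun x y =>
    intervalIntegral.integral_interval_sub_left (hii _ _) (hii _ _)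
  have hAs : StrictMono A := by
    intro x y hxy
    have : 0 < ∫ t in x..y, w t := intervalIntegral.intervalIntegral_pos_of_pos (hii _ _) hwpos hxy
    linarith [hAsub x y]
  set T := ∫ t in Ioi (0:ℝ), w t with hT
  have hAT : Tendsto A atTop (nhds T) := intervalIntegral_tendsto_integral_Ioi 0 hwi.integrableOn tendsto_id
  have hA0 : A 0 = 0 := by simp [hA]
  have hAlt : ∀ x, A x < T := fun x => (hAs (lt_add_one x)).trans_le (hAs.monotone.ge_of_tendsto hAT _)
  have hTpos : 0 < T := by rw [← hA0]; exact hAlt 0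
  have hex : ∀ t, ∃ x, 0 ≤ t → t < 1 → 0 ≤ x ∧ A x = t * T := by
    intro t
    by_cases h : 0 ≤ t ∧ t < 1
    · have h1 : t * T < T := by nlinarith [h.2]
      obtain ⟨y, hy0, hy⟩ := ((eventually_ge_atTop (0:ℝ)).and (hAT.eventually (lt_mem_nhds h1))).exists
      obtain ⟨x, hx, hxe⟩ := intermediate_value_Icc hy0 hAc.continuousOn (show t * T ∈ Icc (A 0) (A y) from ⟨by rw [hA0]; exact mul_nonneg h.1 hTpos.le, hy.le⟩)
      exact ⟨x, fun _ _ => ⟨hx.1, hxe⟩⟩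
    · exact ⟨0, fun h1 h2 => absurd ⟨h1, h2⟩ h⟩
  choose s hs using hex
  have hmono : ∀ a c, 0 ≤ a → a ≤ c → c < 1 → s a ≤ s c := by
    intro a c ha hac hc
    rw [← hAs.le_iff_le, (hs a ha (hac.trans_lt hc)).2, (hs c (ha.trans hac) hc).2]
    gcongr
  have hint : ∀ a c, 0 ≤ a → a ≤ c → c < 1 → ∫ t in (s a)..(s c), w t = T * (c - a) := by
    intro a c ha hac hc
    rw [← hAsub, (hs a ha (hac.trans_lt hc)).2, (hs c (ha.trans hac) hc).2]; ring
  refine ⟨s, fun x => A x / T, T, hTpos.le, fun t h0 h1 => (hs t h0 h1).1, hmono, ?_, ?_, ?_, ?_⟩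
  · intro x hx
    have h0 : 0 ≤ A x / T := div_nonneg (by rw [← hA0]; exact hAs.monotone hx) hTpos.le
    have h1 : A x / T < 1 := by rw [div_lt_one hTpos]; exact hAlt x
    apply hAs.injective
    rw [(hs _ h0 h1).2]; field_simp
  · refine tendsto_nhdsWithin_iff.2 ⟨?_, Eventually.of_forall fun x => ?_⟩
    · have := hAT.div_const T
      rwa [div_self hTpos.ne'] at this
    · show A x / T < 1
      rw [div_lt_one hTpos]; exact hAlt x
  · intro b hb0 hb1
    refine ⟨(1 + (s b)^2) * T, by positivity, fun a c ha hac hcb => ?_⟩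
    have hc1 := hcb.trans_lt hb1
    rw [mul_assoc, ← hint a c ha hac hc1, ← intervalIntegral.integral_const_mul]
    refine intervalIntegral.integral_mono_on (hmono a c ha hac hc1) (locInt_ii hloc _ _).abs ((hii _ _).const_mul _) fun x hx => ?_
    have hx0 : 0 ≤ x := (hs a ha (hac.trans_lt hc1)).1.trans hx.1
    have hxb : x ≤ s b := hx.2.trans (hmono c b (ha.trans hac) hcb hb1)
    have h1 : (1:ℝ) ≤ (1 + (s b)^2) * (1 + x^2)⁻¹ := by
      rw [← div_eq_mul_inv, one_le_div (by positivity)]; gcongr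
    have h2 : |V x| ≤ 1 + |V x| ^ p := by
      rcases le_total (|V x|) 1 with h | h
      · have : 0 ≤ |V x| ^ p := by positivity
        linarith
      · have := Real.rpow_le_rpow_of_exponent_le h hp1
        rw [Real.rpow_one] at this; linarith
    have h3 : 0 ≤ |V x| ^ p := by positivity
    show |V x| ≤ (1 + (s b)^2) * (|V x| ^ p + (1 + x^2)⁻¹)
    nlinarith [mul_nonneg (sq_nonneg (s b)) h3]
  · intro a c ha hac hc
    rw [← hint a c ha hac hc, intervalIntegral.integral_of_le (hmono a c ha hac hc),
      ofReal_integral_eq_lintegral_ofReal hwi.integrableOn (ae_of_all _ fun x => (hwpos x).le)]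
    refine lintegral_mono fun x => ENNReal.ofReal_le_ofReal ?_
    have : 0 ≤ (1 + x^2)⁻¹ := by positivity
    show |V x| ^ p ≤ |V x| ^ p + (1 + x^2)⁻¹
    linarith

theorem gX_ae_loc {p : ℝ} (hp1 : 1 ≤ p) (hp2 : p < 2) {V : ℝ → ℝ} (hmeas : Measurable V)
    (hloc : LocallyIntegrable V) (hLp : Integrable (fun x => |V x| ^ p)) {s : ℝ → ℝ} {T : ℝ} (hT : 0 ≤ T)
    (hs : ∀ a c, 0 ≤ a → a ≤ c → c < 1 → ∫⁻ x in Ioc (s a) (s c), ENNReal.ofReal (|V x| ^ p) ≤ ENNReal.ofReal (T * (c - a)))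
    {α β : ℝ} (hα : 0 < α) (hαβ : α < β) :
    ∀ᵐ k ∂(volume.restrict (Ioc α β)), k < β → ∃ C q : ℝ, 0 ≤ C ∧ 0 < q ∧ q < 1 ∧
      ∀ m, ∑ n ∈ Finset.range (2^m - 1), ‖∫ x in Ioc (s (dy m n)) (s (dy m (n+1))), gX V k x‖ ^ 2 ≤ (C * q^m)^2 := by
  obtain ⟨C, hC, hCb⟩ := L2est hp1 hp2 hmeas hloc hLp hα hαβ
  have hp0 : 0 < p := by linarith
  have hgm := gX_meas hmeas hloc
  have c0 : Continuous (eta α β) := by unfold eta; fun_prop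
  have hXm : ∀ a b, Measurable fun k => ENNReal.ofReal (eta α β k * ‖∫ x in Ioc a b, gX V k x‖ ^ 2) := by
    intro a b
    have : Measurable fun k => ∫ x in Ioc a b, gX V k x :=
      (hgm.stronglyMeasurable.integral_prod_right (ν := volume.restrict (Ioc a b))).measurable
    have := c0.measurable
    fun_prop
  set e := 2 / p - 1 with he
  have he0 : 0 < e := by rw [he, sub_pos, lt_div_iff₀ hp0]; linarith
  set σ : ℝ := 2 ^ (-(e / 2)) with hσ
  have hσ0 : 0 < σ := by positivity
  have hσ1 : σ < 1 := Real.rpow_lt_one_of_one_lt_of_neg (by norm_num) (by linarith)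
  set G : ℕ → ℝ → ENNReal := fun m k => ∑ n ∈ Finset.range (2^m - 1),
    ENNReal.ofReal (eta α β k * ‖∫ x in Ioc (s (dy m n)) (s (dy m (n+1))), gX V k x‖ ^ 2) with hG
  have hGm : ∀ m, Measurable (G m) := fun m => Finset.measurable_fun_sum _ fun n _ => hXm _ _
  have hGb : ∀ m, ∫⁻ k in Ioc α β, G m k ≤ C * ENNReal.ofReal (T ^ (2 / p) * (σ^2)^m) := by
    intro m
    rw [hG]; simp only
    rw [lintegral_finsetSum _ (fun n _ => hXm _ _)]
    have hterm : ∀ n ∈ Finset.range (2^m - 1), ∫⁻ k in Ioc α β, ENNReal.ofReal (eta α β k * ‖∫ x in Ioc (s (dy m n)) (s (dy m (n+1))), gX V k x‖ ^ 2) ≤ C * ENNReal.ofReal ((T * (1 / 2^m)) ^ (2/p)) := by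
      intro n hn
      refine (hCb _ _).trans ?_
      have hn' : n + 1 < 2^m := by have := Finset.mem_range.1 hn; omega
      have h1 : dy m (n+1) < 1 := by
        unfold dy; rw [div_lt_one (by positivity)]; exact_mod_cast hn'
      have h0 : 0 ≤ dy m n := by unfold dy; positivity
      have hd : dy m (n+1) - dy m n = 1 / 2^m := by unfold dy; push_cast; ring
      have h2 : dy m n ≤ dy m (n+1) := by
        have : (0:ℝ) ≤ 1 / 2^m := by positivity
        linarith
      have := hs _ _ h0 h2 h1
      rw [hd] at this
      rw [← ENNReal.ofReal_rpow_of_nonneg (by positivity) (by positivity)]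
      gcongr
    refine (Finset.sum_le_sum hterm).trans ?_
    rw [Finset.sum_const, Finset.card_range, nsmul_eq_mul, mul_left_comm]
    gcongr
    rw [← ENNReal.ofReal_natCast, ← ENNReal.ofReal_mul (by positivity)]
    apply ENNReal.ofReal_le_ofReal
    have e1 : ((1:ℝ) / 2^m) ^ (2/p) = (σ^2)^m * (1/2^m) := by
      rw [hσ, one_div, ← Real.rpow_natCast 2 m, ← Real.rpow_neg (by norm_num), ← Real.rpow_mul (by norm_num),
        ← Real.rpow_natCast, ← Real.rpow_natCast, ← Real.rpow_mul (by positivity), ← Real.rpow_mul (by positivity), ← Real.rpow_add (by positivity)]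
      congr 1
      rw [he]; push_cast; ring
    rw [Real.mul_rpow hT (by positivity), e1]
    have h2 : ((2^m - 1 : ℕ) : ℝ) ≤ 2^m := by
      have : 2^m - 1 ≤ 2^m := Nat.sub_le _ _
      exact_mod_cast this
    calc _ ≤ (2:ℝ)^m * (T ^ (2/p) * ((σ^2)^m * (1/2^m))) := by gcongr
      _ = _ := by field_simp
  have hsum : ∫⁻ k in Ioc α β, ∑' m, ENNReal.ofReal ((σ⁻¹)^m) * G m k ≠ ⊤ := by
    rw [lintegral_tsum (fun m => ((hGm m).const_mul _).aemeasurable)]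
    have hle : ∀ m, ∫⁻ k in Ioc α β, ENNReal.ofReal ((σ⁻¹)^m) * G m k ≤ C * ENNReal.ofReal (T ^ (2/p)) * ENNReal.ofReal (σ)^m := by
      intro m
      rw [lintegral_const_mul _ (hGm m)]
      calc _ ≤ ENNReal.ofReal ((σ⁻¹)^m) * (C * ENNReal.ofReal (T ^ (2 / p) * (σ^2)^m)) := by gcongr; exact hGb m
        _ = C * (ENNReal.ofReal ((σ⁻¹)^m) * ENNReal.ofReal (T ^ (2 / p) * (σ^2)^m)) := by ring
        _ = _ := by
          rw [← ENNReal.ofReal_mul (by positivity), mul_assoc, ← ENNReal.ofReal_pow hσ0.le, ← ENNReal.ofReal_mul (by positivity)]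
          congr 2
          rw [mul_left_comm, ← mul_pow]
          congr 2
          field_simp
    refine ne_top_of_le_ne_top ?_ (ENNReal.tsum_le_tsum hle)
    rw [ENNReal.tsum_mul_left, ENNReal.tsum_geometric]
    refine ENNReal.mul_ne_top (ENNReal.mul_ne_top hC ENNReal.ofReal_ne_top) ?_
    rw [ENNReal.inv_ne_top]
    exact (tsub_pos_of_lt (by rw [← ENNReal.ofReal_one]; exact (ENNReal.ofReal_lt_ofReal_iff one_pos).2 hσ1)).ne'
  have hfin := ae_lt_top' (Measurable.tsum fun m => (hGm m).const_mul _).aemeasurable hsum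
  filter_upwards [hfin, ae_restrict_mem measurableSet_Ioc] with k hk hkm hkβ
  set M := (∑' m, ENNReal.ofReal ((σ⁻¹)^m) * G m k).toReal with hM
  have heta : 0 < eta α β k := by
    unfold eta
    have : 0 < k - α := by linarith [hkm.1]
    have : 0 < β - k := by linarith
    positivity
  have hM0 : 0 ≤ M := ENNReal.toReal_nonneg
  refine ⟨√(M / eta α β k), √σ, by positivity, by positivity, by rw [Real.sqrt_lt' one_pos]; simpa using hσ1, fun m => ?_⟩
  have h1 : ENNReal.ofReal ((σ⁻¹)^m) * G m k ≤ ENNReal.ofReal M := by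
    rw [hM, ENNReal.ofReal_toReal hk.ne]
    exact ENNReal.le_tsum m
  have h2 : G m k = ENNReal.ofReal (eta α β k * ∑ n ∈ Finset.range (2^m - 1), ‖∫ x in Ioc (s (dy m n)) (s (dy m (n+1))), gX V k x‖ ^ 2) := by
    rw [Finset.mul_sum, ENNReal.ofReal_sum_of_nonneg (fun n _ => by positivity)]
  rw [h2, ← ENNReal.ofReal_mul (by positivity), ENNReal.ofReal_le_ofReal_iff hM0] at h1
  rw [mul_pow, Real.sq_sqrt (by positivity), ← pow_mul, mul_comm m 2, pow_mul, Real.sq_sqrt hσ0.le]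
  rw [inv_pow, inv_mul_le_iff₀ (by positivity)] at h1
  rw [div_mul_eq_mul_div, le_div_iff₀ heta]
  linarith

theorem gX_ae {p : ℝ} (hp1 : 1 ≤ p) (hp2 : p < 2) {V : ℝ → ℝ} (hmeas : Measurable V)
    (hloc : LocallyIntegrable V) (hLp : Integrable (fun x => |V x| ^ p)) {s : ℝ → ℝ} {T : ℝ} (hT : 0 ≤ T)
    (hs : ∀ a c, 0 ≤ a → a ≤ c → c < 1 → ∫⁻ x in Ioc (s a) (s c), ENNReal.ofReal (|V x| ^ p) ≤ ENNReal.ofReal (T * (c - a))) :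
    ∀ᵐ k ∂(volume.restrict (Ioi (0:ℝ))), ∃ C q : ℝ, 0 ≤ C ∧ 0 < q ∧ q < 1 ∧
      ∀ m, ∑ n ∈ Finset.range (2^m - 1), ‖∫ x in Ioc (s (dy m n)) (s (dy m (n+1))), gX V k x‖ ^ 2 ≤ (C * q^m)^2 := by
  rw [ae_restrict_iff' measurableSet_Ioi]
  have h : ∀ N : ℕ, _ := fun N => (ae_restrict_iff' measurableSet_Ioc).1 (gX_ae_loc hp1 hp2 hmeas hloc hLp hT hs
    (α := 1 / (N + 2)) (β := N + 2) (by positivity) (by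
      rw [div_lt_iff₀ (by positivity)]; nlinarith [Nat.cast_nonneg (α := ℝ) N]))
  filter_upwards [ae_all_iff.2 h] with k hk hk0
  have hk0' : 0 < k := hk0
  obtain ⟨N, hN⟩ := exists_nat_gt (max k k⁻¹)
  have h1 : k < N := (le_max_left _ _).trans_lt hN
  have h2 : k⁻¹ < N := (le_max_right _ _).trans_lt hN
  refine hk N ⟨?_, by linarith⟩ (by linarith)
  rw [div_lt_iff₀ (by positivity)]
  have := (inv_lt_iff_one_lt_mul₀ hk0').1 h2
  nlinarith

theorem prim_local {ζ y : ℝ → ℂ} (hζ : LocallyIntegrable ζ) (hy : Prim y (fun x => ζ x * star (y x))) {x x' Y : ℝ} (hx : x ≤ x')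
    (hY : ∀ t ∈ Icc x x', ‖y t‖ ≤ Y) :
    ‖y x' - y x‖ ≤ Y * ∫ t in x..x', ‖ζ t‖ := by
  rw [hy.sub_eq, ← intervalIntegral.integral_const_mul]
  refine intervalIntegral.norm_integral_le_of_norm_le hx (ae_of_all _ fun t ht => ?_) ((locInt_ii hζ _ _).norm.const_mul _)
  rw [norm_mul, norm_star, mul_comm]
  gcongr
  exact hY t ⟨ht.1.le, ht.2⟩

theorem prim_local2 {ζ y : ℝ → ℂ} (hζ : LocallyIntegrable ζ) (hy : Prim y (fun x => ζ x * star (y x))) {x x' Y : ℝ} (hx : x ≤ x')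
    (hY0 : 0 ≤ Y) (hY : ∀ t ∈ Icc x x', ‖y t‖ ≤ Y) :
    ‖y x' - y x - (∫ t in x..x', ζ t) * star (y x)‖ ≤ Y * (∫ t in x..x', ‖ζ t‖) ^ 2 := by
  have hi := locInt_ii hζ
  set J := ∫ t in x..x', ‖ζ t‖ with hJ
  rw [hy.sub_eq, ← intervalIntegral.integral_mul_const, ← intervalIntegral.integral_sub (locInt_ii hy.1 _ _) ((hi _ _).mul_const _)]
  have e : Y * J ^ 2 = ∫ t in x..x', (Y * J) * ‖ζ t‖ := by
    rw [intervalIntegral.integral_const_mul, ← hJ]; ring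
  rw [e]
  refine intervalIntegral.norm_integral_le_of_norm_le hx (ae_of_all _ fun t ht => ?_) ((hi _ _).norm.const_mul _)
  rw [← mul_sub, norm_mul, ← star_sub, norm_star, mul_comm]
  gcongr
  refine (prim_local hζ hy ht.1.le fun r hr => hY r ⟨hr.1, hr.2.trans ht.2⟩).trans ?_
  gcongr
  exact intervalIntegral.integral_mono_interval le_rfl ht.1.le ht.2 (ae_of_all _ fun _ => norm_nonneg _) (hi _ _).norm

noncomputable def zet (V : ℝ → ℝ) (k x : ℝ) : ℂ := -(Complex.I / (2 * k)) * star (gX V k x)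

theorem gX_loc {V : ℝ → ℝ} (hloc : LocallyIntegrable V) (k : ℝ) : LocallyIntegrable (gX V k) := by
  have hW : Continuous fun x => ∫ t in (0:ℝ)..x, V t :=
    intervalIntegral.continuous_primitive (fun a b => locInt_ii hloc a b) 0
  have hV : LocallyIntegrable (fun x => (V x : ℂ)) := fun x => by
    obtain ⟨u, hu, hi⟩ := hloc x
    exact ⟨u, hu, hi.ofReal⟩
  exact locInt_mul hV (by fun_prop)

theorem zet_loc {V : ℝ → ℝ} (hloc : LocallyIntegrable V) (k : ℝ) : LocallyIntegrable (zet V k) := by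
  intro x
  obtain ⟨u, hu, hi⟩ := gX_loc hloc k x
  refine ⟨u, hu, ?_⟩
  have h2 : Integrable (fun x => star (gX V k x)) (volume.restrict u) := by
    refine Integrable.mono hi (continuous_star.comp_aestronglyMeasurable hi.1) (ae_of_all _ fun x => ?_)
    rw [norm_star]
  exact h2.const_mul _

theorem zet_norm {V : ℝ → ℝ} {k : ℝ} (hk : 0 < k) (x : ℝ) : ‖zet V k x‖ = 1 / (2 * k) * |V x| := by
  unfold zet
  rw [norm_mul, norm_star, gX_norm, Real.norm_eq_abs]
  congr 1
  simp [abs_of_pos hk]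

theorem sol_limit {V : ℝ → ℝ} (hloc : LocallyIntegrable V) {s τ : ℝ → ℝ}
    (h0 : ∀ t, 0 ≤ t → t < 1 → 0 ≤ s t)
    (hm : ∀ a c, 0 ≤ a → a ≤ c → c < 1 → s a ≤ s c)
    (hst : ∀ x, 0 ≤ x → s (τ x) = x)
    (hτ : Tendsto τ atTop (nhdsWithin 1 (Iio 1)))
    (hK : ∀ b, 0 ≤ b → b < 1 → ∃ K, 0 ≤ K ∧ ∀ a c, 0 ≤ a → a ≤ c → c ≤ b → ∫ x in (s a)..(s c), |V x| ≤ K * (c - a))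
    {k : ℝ} (hk : 0 < k)
    (hX : ∃ C q : ℝ, 0 ≤ C ∧ 0 < q ∧ q < 1 ∧
      ∀ m, ∑ n ∈ Finset.range (2^m - 1), ‖∫ x in Ioc (s (dy m n)) (s (dy m (n+1))), gX V k x‖ ^ 2 ≤ (C * q^m)^2)
    {y : ℝ → ℂ} (hy : Prim y (fun x => zet V k x * star (y x))) :
    ∃ l, Tendsto y atTop (nhds l) := by
  obtain ⟨C, q, hC, hq0, hq1, hG⟩ := hX
  have hζ := zet_loc hloc k
  set κ := 1 / (2 * k) with hκ
  have hκ0 : 0 < κ := by positivity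
  have hnorm : ∀ a b, ∫ t in a..b, ‖zet V k t‖ = κ * ∫ t in a..b, |V t| := by
    intro a b
    rw [← intervalIntegral.integral_const_mul]
    congr 1; ext t; exact zet_norm hk t
  have hZsub : ∀ x x', (∫ t in (0:ℝ)..x', zet V k t) - ∫ t in (0:ℝ)..x, zet V k t = ∫ t in x..x', zet V k t := fun x x' =>
    intervalIntegral.integral_interval_sub_left (locInt_ii hζ _ _) (locInt_ii hζ _ _)
  have := young_limit (f := fun t => y (s t)) (Z := fun t => ∫ x in (0:ℝ)..(s t), zet V k x) (C := κ * C) (q := q)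
    (by positivity) hq0 hq1 ?_ ?_
  · obtain ⟨l, hl⟩ := this
    refine ⟨l, (hl.comp hτ).congr' ?_⟩
    filter_upwards [eventually_ge_atTop 0] with x hx
    simp only [Function.comp, hst x hx]
  · intro b hb0 hb1
    obtain ⟨K, hK0, hKb⟩ := hK b hb0 hb1
    obtain ⟨Y, hY⟩ := (isCompact_Icc (a := (0:ℝ)) (b := s b)).exists_bound_of_continuousOn hy.continuous.continuousOn
    have hY0 : 0 ≤ Y := (norm_nonneg _).trans (hY 0 ⟨le_rfl, h0 b hb0 hb1⟩)
    refine ⟨Y * (κ * K) + Y * (κ * K)^2, by positivity, fun a c ha hac hcb => ?_⟩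
    have hc1 := hcb.trans_lt hb1
    have hsac := hm a c ha hac hc1
    have hYY : ∀ t ∈ Icc (s a) (s c), ‖y t‖ ≤ Y := fun t ht =>
      hY t ⟨(h0 a ha (hac.trans_lt hc1)).trans ht.1, ht.2.trans (hm c b (ha.trans hac) hcb hb1)⟩
    have hJ := hKb a c ha hac hcb
    have hJ0 : 0 ≤ ∫ x in (s a)..(s c), |V x| := intervalIntegral.integral_nonneg hsac fun _ _ => abs_nonneg _
    have hac0 : 0 ≤ c - a := by linarith
    constructor
    · refine (prim_local hζ hy hsac hYY).trans ?_
      rw [hnorm]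
      calc _ ≤ Y * (κ * (K * (c - a))) := by gcongr
        _ = Y * (κ * K) * (c - a) := by ring
        _ ≤ _ := by gcongr; linarith [show 0 ≤ Y * (κ * K)^2 by positivity]
    · simp only [hZsub]
      refine (prim_local2 hζ hy hsac hY0 hYY).trans ?_
      rw [hnorm]
      calc _ ≤ Y * (κ * (K * (c - a)))^2 := by gcongr
        _ = Y * (κ * K)^2 * (c - a)^2 := by ring
        _ ≤ _ := by gcongr; linarith [show 0 ≤ Y * (κ * K) by positivity]
  · intro m
    have hterm : ∀ n ∈ Finset.range (2^m - 1), dz (fun t => ∫ x in (0:ℝ)..(s t), zet V k x) m n ^ 2 =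
        κ^2 * ‖∫ x in Ioc (s (dy m n)) (s (dy m (n+1))), gX V k x‖ ^ 2 := by
      intro n hn
      have hn' : n + 1 < 2^m := by have := Finset.mem_range.1 hn; omega
      unfold dz
      simp only [hZsub]
      rw [intervalIntegral.integral_of_le (hm _ _ (dy_nonneg _ _) (dy_mono m (Nat.le_succ n)) (dy_lt_one hn'))]
      unfold zet
      rw [integral_const_mul]
      have : ∫ x in Ioc (s (dy m n)) (s (dy m (n+1))), star (gX V k x) = star (∫ x in Ioc (s (dy m n)) (s (dy m (n+1))), gX V k x) := integral_conj
      rw [this, norm_mul, norm_star, mul_pow]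
      congr 2
      simp [hκ, abs_of_pos hk]
    rw [Finset.sum_congr rfl hterm, ← Finset.mul_sum]
    calc _ ≤ κ^2 * (C * q^m)^2 := by gcongr; exact hG m
      _ = _ := by ring

theorem sol_limit_ae {p : ℝ} (hp1 : 1 ≤ p) (hp2 : p < 2) {V : ℝ → ℝ} (hmeas : Measurable V)
    (hloc : LocallyIntegrable V) (hLp : Integrable (fun x => |V x| ^ p)) :
    ∀ᵐ k ∂(volume.restrict (Ioi (0:ℝ))), 0 < k ∧ ∀ y : ℝ → ℂ, Prim y (fun x => zet V k x * star (y x)) →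
      ∃ l, Tendsto y atTop (nhds l) := by
  obtain ⟨s, τ, T, hT, h0, hm, hst, hτ, hK, hs⟩ := repar hp1 hloc hLp
  filter_upwards [gX_ae hp1 hp2 hmeas hloc hLp hT hs, ae_restrict_mem measurableSet_Ioi] with k hk hk0
  exact ⟨hk0, fun y hy => sol_limit hloc h0 hm hst hτ hK hk0 hk hy⟩

theorem sol_of_prim {V : ℝ → ℝ} {k : ℝ} {u v : ℝ → ℂ} (hu : Prim u v)
    (hv : Prim v (fun x => ((V x : ℂ) - ((k^2 : ℝ) : ℂ)) * u x)) : SchrodingerSolution V (k^2) u := by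
  have hd : ∀ x, HasDerivAt u (v x) x := by
    intro x
    have h := intervalIntegral.integral_hasDerivAt_right (locInt_ii hu.1 0 x)
      hv.continuous.aestronglyMeasurable.stronglyMeasurableAtFilter hv.continuous.continuousAt
    have e : u = fun x => u 0 + ∫ t in (0:ℝ)..x, v t := funext hu.2
    rw [e]
    exact h.const_add _
  refine ⟨fun x => (hd x).differentiableAt, fun x => ?_⟩
  rw [(hd x).deriv, (hd 0).deriv]
  exact hv.2 x

noncomputable def phE (V : ℝ → ℝ) (k x : ℝ) : ℂ :=
  Complex.exp (Complex.I * ((k * x - (1 / (2 * k)) * ∫ y in (0:ℝ)..x, V y : ℝ) : ℂ))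

theorem phE_mul (V : ℝ → ℝ) (k x : ℝ) : star (phE V k x) * phE V k x = 1 := by
  unfold phE
  rw [Complex.star_def, ← Complex.exp_conj, ← Complex.exp_add, map_mul, Complex.conj_I, Complex.conj_ofReal]
  simp

theorem phE_star (V : ℝ → ℝ) (k x : ℝ) : Complex.exp (-(Complex.I *
        ((k * x - (1 / (2 * k)) * ∫ y in (0:ℝ)..x, V y : ℝ) : ℂ))) = star (phE V k x) := by
  unfold phE
  rw [Complex.star_def, ← Complex.exp_conj, map_mul, Complex.conj_I, Complex.conj_ofReal, neg_mul]

theorem phE_prim {V : ℝ → ℝ} (hloc : LocallyIntegrable V) (k : ℝ) :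
    Prim (phE V k) (fun x => (Complex.I * ((k - 1 / (2 * k) * V x : ℝ) : ℂ)) * phE V k x) := by
  have h1 : LocallyIntegrable (fun x => k - 1 / (2 * k) * V x) := by
    have a : LocallyIntegrable (fun _ : ℝ => k) := continuous_const.locallyIntegrable
    have b := hloc.smul (1 / (2 * k))
    exact a.sub b
  have h := prim_expI h1
  have e : ∀ x, ∫ t in (0:ℝ)..x, (k - 1 / (2 * k) * V t) = k * x - (1 / (2 * k)) * ∫ y in (0:ℝ)..x, V y := by
    intro x
    rw [intervalIntegral.integral_sub (by simp) ((locInt_ii hloc _ _).const_mul _), intervalIntegral.integral_const_mul]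
    simp [mul_comm]
  simp only [e] at h
  exact h

theorem zet_eq (V : ℝ → ℝ) {k : ℝ} (hk : 0 < k) (x : ℝ) :
    zet V k x = -(Complex.I / (2 * k)) * V x * star (phE V k x) ^ 2 := by
  have hk' : (k:ℂ) ≠ 0 := by exact_mod_cast hk.ne'
  unfold zet gX phE
  have hV : star ((V x : ℝ) : ℂ) = V x := Complex.conj_ofReal _
  rw [star_mul', ← star_pow, ← Complex.exp_nat_mul, hV, ← mul_assoc]
  congr 3
  push_cast
  field_simp

theorem uv_prim {V : ℝ → ℝ} (hloc : LocallyIntegrable V) {k : ℝ} (hk : 0 < k) {y : ℝ → ℂ}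
    (hy : Prim y (fun x => zet V k x * star (y x))) :
    Prim (fun x => y x * phE V k x + star (y x * phE V k x))
      (fun x => Complex.I * k * (y x * phE V k x + (-1) * star (y x * phE V k x))) ∧
    Prim (fun x => Complex.I * k * (y x * phE V k x + (-1) * star (y x * phE V k x)))
      (fun x => ((V x : ℂ) - ((k^2 : ℝ) : ℂ)) * (y x * phE V k x + star (y x * phE V k x))) := by
  have hk' : (k:ℂ) ≠ 0 := by exact_mod_cast hk.ne'
  have hz := hy.mul (phE_prim hloc k)
  have key : ∀ x, zet V k x * star (y x) * phE V k x + Complex.I * ((k - 1 / (2 * k) * V x : ℝ) : ℂ) * phE V k x * y x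
      = Complex.I * k * (y x * phE V k x) - (Complex.I / (2 * k)) * V x * (y x * phE V k x + star (y x * phE V k x)) := by
    intro x
    rw [zet_eq V hk, star_mul']
    push_cast
    linear_combination (-(Complex.I / (2 * k)) * V x * star (phE V k x) * star (y x)) * phE_mul V k x
  simp only [key] at hz
  have hI : Complex.I ^ 2 = -1 := Complex.I_sq
  constructor
  · have := hz.add hz.conj
    convert this using 2 with x
    simp only [Complex.star_def, map_sub, map_add, map_mul, map_div₀, Complex.conj_I, Complex.conj_ofReal, Complex.conj_conj, map_ofNat]
    ring
  · have := (hz.add (hz.conj.const_mul (-1))).const_mul (Complex.I * k)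
    convert this using 2 with x
    simp only [Complex.star_def, map_sub, map_add, map_mul, map_div₀, Complex.conj_I, Complex.conj_ofReal, Complex.conj_conj, map_ofNat]
    push_cast
    field_simp
    ring_nf
    rw [hI]
    ring

theorem up_exists {V : ℝ → ℝ} (hloc : LocallyIntegrable V) {k : ℝ} (hk : 0 < k)
    (hlim : ∀ y : ℝ → ℂ, Prim y (fun x => zet V k x * star (y x)) → ∃ l, Tendsto y atTop (nhds l)) :
    ∃ up, SchrodingerSolution V (k^2) up ∧ HasWKBAsymptotics V k up atTop := by
  have hζ := zet_loc hloc k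
  obtain ⟨y1, h10, h1⟩ := volterra hζ 1
  obtain ⟨y2, h20, h2⟩ := volterra hζ Complex.I
  obtain ⟨l1, hl1⟩ := hlim y1 h1
  obtain ⟨l2, hl2⟩ := hlim y2 h2
  have hW := (h1.mul h2.conj).add ((h1.conj.mul h2).const_mul (-1))
  have hWc : ∀ x, y1 x * star (y2 x) + -1 * (star (y1 x) * y2 x) = -2 * Complex.I := by
    intro x
    refine (hW.2 x).trans ?_
    simp only
    have e : (fun t => zet V k t * star (y1 t) * star (y2 t) + star (zet V k t * star (y2 t)) * y1 t +
        -1 * (star (zet V k t * star (y1 t)) * y2 t + zet V k t * star (y2 t) * star (y1 t))) = fun _ => 0 := by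
      ext t
      simp only [star_mul', star_star]
      ring
    rw [e, h10, h20]
    simp
    ring
  have cs1 : Tendsto (fun x => star (y1 x)) atTop (nhds (star l1)) := (continuous_star.tendsto l1).comp hl1
  have cs2 : Tendsto (fun x => star (y2 x)) atTop (nhds (star l2)) := (continuous_star.tendsto l2).comp hl2
  have hΔ : l1 * star l2 + -1 * (star l1 * l2) = -2 * Complex.I := by
    have t1 := (hl1.mul cs2).add ((cs1.mul hl2).const_mul (-1))
    simp only [hWc] at t1
    exact tendsto_nhds_unique t1 tendsto_const_nhds |>.symm ▸ rfl
  set Δ := -2 * Complex.I with hΔd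
  have hΔ0 : Δ ≠ 0 := by simp [hΔd]
  obtain ⟨a1, b1⟩ := uv_prim hloc hk h1
  obtain ⟨a2, b2⟩ := uv_prim hloc hk h2
  set lam := star l2 / Δ with hlam
  set mu := -(star l1 / Δ) with hmu
  refine ⟨fun x => lam * (y1 x * phE V k x + star (y1 x * phE V k x)) + mu * (y2 x * phE V k x + star (y2 x * phE V k x)),
    sol_of_prim ((a1.const_mul lam).add (a2.const_mul mu)) ?_, ?_⟩
  · convert (b1.const_mul lam).add (b2.const_mul mu) using 2 with x
    ring
  · unfold HasWKBAsymptotics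
    simp only [phE_star]
    have e : ∀ x, (lam * (y1 x * phE V k x + star (y1 x * phE V k x)) + mu * (y2 x * phE V k x + star (y2 x * phE V k x))) * star (phE V k x)
        = (lam * y1 x + mu * y2 x) + (lam * star (y1 x) + mu * star (y2 x)) * star (phE V k x) ^ 2 := by
      intro x
      simp only [star_mul']
      linear_combination (lam * y1 x + mu * y2 x) * phE_mul V k x
    simp only [e]
    have t1 : Tendsto (fun x => lam * y1 x + mu * y2 x) atTop (nhds 1) := by
      have := (hl1.const_mul lam).add (hl2.const_mul mu)
      convert this using 2
      rw [hlam, hmu]; field_simp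
      linear_combination -hΔ
    have t2 : Tendsto (fun x => lam * star (y1 x) + mu * star (y2 x)) atTop (nhds 0) := by
      have := (cs1.const_mul lam).add (cs2.const_mul mu)
      convert this using 2
      rw [hlam, hmu]; ring
    have t3 : Tendsto (fun x => (lam * star (y1 x) + mu * star (y2 x)) * star (phE V k x) ^ 2) atTop (nhds 0) := by
      rw [tendsto_zero_iff_norm_tendsto_zero] at t2 ⊢
      convert t2 using 2 with x
      rw [norm_mul, norm_pow, norm_star]
      have : ‖phE V k x‖ = 1 := by
        unfold phE; rw [mul_comm, Complex.norm_exp_ofReal_mul_I]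
      rw [this]; simp
    simpa using t1.add t3

theorem um_of_up {V : ℝ → ℝ} {k : ℝ}
    (h : ∃ up, SchrodingerSolution (fun x => V (-x)) (k^2) up ∧ HasWKBAsymptotics (fun x => V (-x)) k up atTop) :
    ∃ um, SchrodingerSolution V (k^2) um ∧ HasWKBAsymptotics V k um atBot := by
  obtain ⟨u, ⟨hd, hu⟩, hw⟩ := h
  have hder : ∀ x, HasDerivAt (fun x => star (u (-x))) (-star (deriv u (-x))) x := by
    intro x
    have h1 : HasDerivAt (fun x => u (-x)) (-(deriv u (-x))) x := by
      have := (hd (-x)).hasDerivAt.scomp x (hasDerivAt_neg x)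
      simp only [neg_smul, one_smul] at this
      exact this
    have := h1.star
    simpa using this
  refine ⟨fun x => star (u (-x)), ⟨fun x => (hder x).differentiableAt, fun x => ?_⟩, ?_⟩
  · rw [(hder x).deriv, (hder 0).deriv, hu (-x), neg_zero, star_add, neg_add]
    congr 1
    have e := intervalIntegral.integral_comp_neg (a := 0) (b := x) (fun y => ((V (-y) : ℂ) - ((k^2 : ℝ) : ℂ)) * u y)
    rw [neg_zero] at e
    rw [intervalIntegral.integral_symm, ← e, star_neg, neg_neg]
    rw [intervalIntegral, intervalIntegral, star_sub]
    have c : ∀ (S : Set ℝ) (f : ℝ → ℂ), star (∫ y in S, f y) = ∫ y in S, star (f y) := fun S f => integral_conj.symm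
    rw [c, c]
    simp [Complex.conj_ofReal]
  · unfold HasWKBAsymptotics at hw ⊢
    have h1 := (continuous_star.tendsto (1:ℂ)).comp (hw.comp tendsto_neg_atBot_atTop)
    rw [star_one] at h1
    refine h1.congr fun x => ?_
    have e := intervalIntegral.integral_comp_neg (a := 0) (b := -x) V
    rw [neg_zero, neg_neg, intervalIntegral.integral_symm 0 x] at e
    simp only [Function.comp, e]
    rw [star_mul']
    congr 1
    rw [Complex.star_def, ← Complex.exp_conj]
    congr 1
    simp only [map_neg, map_mul, Complex.conj_I, Complex.conj_ofReal]
    push_cast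
    ring

/-- **Christ–Kiselev WKB asymptotics.** For `V ∈ Lᵖ(ℝ)`, `1 ≤ p < 2`, and almost
every `k > 0` there exist solutions `u₊, u₋` of `-u'' + V u = k² u` with WKB
asymptotics at `+∞` and `-∞` respectively. -/
theorem christ_kiselev_wkb
    (p : ℝ) (hp1 : 1 ≤ p) (hp2 : p < 2)
    (V : ℝ → ℝ) (hmeas : Measurable V)
    (hloc : LocallyIntegrable V)
    (hLp : Integrable (fun x => |V x| ^ p)) :
    ∀ᵐ k ∂(volume.restrict (Ioi (0 : ℝ))),
      ∃ up um : ℝ → ℂ,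
        SchrodingerSolution V (k ^ 2) up ∧
        SchrodingerSolution V (k ^ 2) um ∧
        HasWKBAsymptotics V k up atTop ∧
        HasWKBAsymptotics V k um atBot := by
  have hmeas' : Measurable (fun x => V (-x)) := hmeas.comp measurable_neg
  have hloc' : LocallyIntegrable (fun x => V (-x)) := by
    rw [locallyIntegrable_iff]
    intro K hK
    have h1 : IntegrableOn V (-K) := hloc.integrableOn_isCompact hK.neg
    have := (Measure.measurePreserving_neg (volume : Measure ℝ)).integrableOn_comp_preimage
      (Homeomorph.neg ℝ).measurableEmbedding (f := V) (s := -K)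
    have h2 := this.2 h1
    simpa [Function.comp_def] using h2
  have hLp' : Integrable (fun x => |V (-x)| ^ p) := hLp.comp_neg
  filter_upwards [sol_limit_ae hp1 hp2 hmeas hloc hLp, sol_limit_ae hp1 hp2 hmeas' hloc' hLp'] with k h1 h2
  obtain ⟨up, a, b⟩ := up_exists hloc h1.1 h1.2
  obtain ⟨um, c, d⟩ := um_of_up (up_exists hloc' h2.1 h2.2)
  exact ⟨up, um, a, c, b, d⟩
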